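/- Let 0 < c1 ≤ c2 be constants and let n range over an increasing sequence of integers along which c1 ≤ f(k0(n)+1) ≤ c2. Then for G = G(n,1/2): (1) the probability that one of the following four events holds tends to 1 as n → ∞: (a) α(G)=k0+1 and β(G)=k0+3; (b) α(G)=k0+1 and β(G)=k0+2; (c) α(G)=k0 and β(G)=k0+3; (d) α(G)=k0 and β(G)=k0+2; and (2) for each of the four events, its probability is bounded away from 0 and from 1 along the sequence. -/

import Mathlib

open MeasureTheory ProbabilityTheory Filter Real

namespace RandomBipartiteDecomposition

/-- The set of edges of the complete bipartite graph with vertex classes `A` and `B`. -/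
def bicliqueEdges {V : Type*} (A B : Finset V) : Set (Sym2 V) :=
  {e | ∃ a ∈ A, ∃ b ∈ B, e = s(a, b)}

/-- `A`, `B` are the vertex classes of a complete bipartite subgraph of `G`. -/
def IsBicliqueIn {V : Type*} (G : SimpleGraph V) (A B : Finset V) : Prop :=
  A.Nonempty ∧ B.Nonempty ∧ Disjoint A B ∧ ∀ a ∈ A, ∀ b ∈ B, G.Adj a b

/-- A complete bipartite subgraph is nontrivial if both classes have at least 2 vertices. -/
def IsNontrivialBicliqueIn {V : Type*} (G : SimpleGraph V) (A B : Finset V) : Prop :=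
  2 ≤ A.card ∧ 2 ≤ B.card ∧ Disjoint A B ∧ ∀ a ∈ A, ∀ b ∈ B, G.Adj a b

/-- `P` lists `m` pairwise edge-disjoint complete bipartite subgraphs of `G` such that
every edge of `G` belongs to exactly one of them. -/
def IsBicliqueDecomp {V : Type*} (G : SimpleGraph V) (m : ℕ)
    (P : Fin m → Finset V × Finset V) : Prop :=
  (∀ i, IsBicliqueIn G (P i).1 (P i).2) ∧
  (∀ i j, i ≠ j →
    Disjoint (bicliqueEdges (P i).1 (P i).2) (bicliqueEdges (P j).1 (P j).2)) ∧
  (⋃ i, bicliqueEdges (P i).1 (P i).2) = G.edgeSet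

/-- As above but with all complete bipartite subgraphs nontrivial. -/
def IsNontrivialBicliqueDecomp {V : Type*} (G : SimpleGraph V) (m : ℕ)
    (P : Fin m → Finset V × Finset V) : Prop :=
  (∀ i, IsNontrivialBicliqueIn G (P i).1 (P i).2) ∧
  (∀ i j, i ≠ j →
    Disjoint (bicliqueEdges (P i).1 (P i).2) (bicliqueEdges (P j).1 (P j).2)) ∧
  (⋃ i, bicliqueEdges (P i).1 (P i).2) = G.edgeSet

/-- `τ(G)`: the minimum number of pairwise edge-disjoint complete bipartite subgraphs
of `G` so that each edge of `G` belongs to exactly one of them. -/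
noncomputable def tau {V : Type*} (G : SimpleGraph V) : ℕ :=
  sInf {m | ∃ P : Fin m → Finset V × Finset V, IsBicliqueDecomp G m P}

/-- `τ'(G)`: the minimum number of pairwise edge-disjoint *nontrivial* complete bipartite
subgraphs of `G` covering all edges of `G`; `⊤` if there is no such cover. -/
noncomputable def tau' {V : Type*} (G : SimpleGraph V) : ℕ∞ :=
  sInf {t : ℕ∞ | ∃ m : ℕ, t = m ∧ ∃ P : Fin m → Finset V × Finset V,
    IsNontrivialBicliqueDecomp G m P}

/-- `S` is an independent set of `G`. -/
def IsIndepFinset {V : Type*} (G : SimpleGraph V) (S : Finset V) : Prop :=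
  ∀ a ∈ S, ∀ b ∈ S, ¬ G.Adj a b

/-- `α(G)`: the maximum size of an independent set of `G`. -/
noncomputable def alpha {V : Type*} (G : SimpleGraph V) : ℕ :=
  sSup {k | ∃ S : Finset V, S.card = k ∧ IsIndepFinset G S}

/-- `S` induces in `G` a complete bipartite graph with nonempty vertex classes `A`, `B`. -/
def IsInducedCompleteBipartite {V : Type*} (G : SimpleGraph V) (S A B : Finset V) : Prop :=
  A.Nonempty ∧ B.Nonempty ∧ Disjoint A B ∧ (A : Set V) ∪ (B : Set V) = (S : Set V) ∧
  ∀ u ∈ S, ∀ v ∈ S, (G.Adj u v ↔ ((u ∈ A ∧ v ∈ B) ∨ (u ∈ B ∧ v ∈ A)))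

/-- `β(G)`: the largest number of vertices of an induced complete bipartite subgraph. -/
noncomputable def beta {V : Type*} (G : SimpleGraph V) : ℕ :=
  sSup {k | ∃ S A B : Finset V, IsInducedCompleteBipartite G S A B ∧ S.card = k}

/-- The Bernoulli measure on `Bool` giving `true` probability `p`. -/
noncomputable def bernoulliBool (p : ℝ) : Measure Bool :=
  p.toNNReal • Measure.dirac true + (1 - p).toNNReal • Measure.dirac false

instance (p : ℝ) : IsFiniteMeasure (bernoulliBool p) := by
  unfold bernoulliBool; infer_instance

/-- The Erdős–Rényi random graph `G(n,p)`: each unordered pair of vertices flips an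
independent `p`-coin. Events about the graph are subsets of the coin-flip space. -/
noncomputable def erdosRenyi (n : ℕ) (p : ℝ) : Measure (Sym2 (Fin n) → Bool) :=
  Measure.pi fun _ => bernoulliBool p

/-- The simple graph determined by the coin flips `ω`. -/
def graphOf (n : ℕ) (ω : Sym2 (Fin n) → Bool) : SimpleGraph (Fin n) :=
  SimpleGraph.fromEdgeSet {e | ω e = true}

/-- `f(k) = C(n,k) · 2^{-C(k,2)}`, the expected number of independent sets of size `k`
in `G(n,1/2)`. -/
noncomputable def f (n k : ℕ) : ℝ :=
  (n.choose k : ℝ) * (2 : ℝ) ^ (-(k.choose 2 : ℤ))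

/-- `k₀(n)`: the largest `k` with `f(k) ≥ 1`. -/
noncomputable def k0 (n : ℕ) : ℕ := sSup {k | 1 ≤ f n k}

/-- `g(k) = C(n,k+2) · (2^{k+1} - 1) · 2^{-C(k+2,2)}`, the expected number of induced
complete bipartite subgraphs on `k+2` vertices in `G(n,1/2)`. -/
noncomputable def g (n k : ℕ) : ℝ :=
  (n.choose (k + 2) : ℝ) * ((2 : ℝ) ^ (k + 1) - 1) * (2 : ℝ) ^ (-((k + 2).choose 2 : ℤ))

/-- The number of independent sets of size `k` in the graph determined by `ω`. -/
noncomputable def numIndep (n k : ℕ) (ω : Sym2 (Fin n) → Bool) : ℕ :=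
  Set.ncard {S : Finset (Fin n) | S.card = k ∧ IsIndepFinset (graphOf n ω) S}

/-- The number of `m`-element vertex subsets inducing a complete bipartite graph in the
graph determined by `ω`. -/
noncomputable def numBip (n m : ℕ) (ω : Sym2 (Fin n) → Bool) : ℕ :=
  Set.ncard {S : Finset (Fin n) | S.card = m ∧
    ∃ A B : Finset (Fin n), IsInducedCompleteBipartite (graphOf n ω) S A B}

section Abstract

variable {Ω ι : Type*} [MeasurableSpace Ω] [DiscreteMeasurableSpace Ω]
  {μ : Measure Ω} [IsProbabilityMeasure μ]

/-- The probability that no event of a family occurs, compared with the product of the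
probabilities of the complements, in terms of the pairs of dependent events. -/
theorem prod_one_sub_le_prob_avoid_and_le [DecidableEq ι] (A : ι → Set Ω) (N : ι → ι → Prop)
    [DecidableRel N]
    (hind : ∀ i, ∀ F : Finset ι, (∀ j ∈ F, ¬ N i j) →
      μ.real (A i ∩ ⋂ j ∈ F, (A j)ᶜ) = μ.real (A i) * μ.real (⋂ j ∈ F, (A j)ᶜ))
    (V : Finset ι) :
    ∏ i ∈ V, (1 - μ.real (A i)) -
        ∑ i ∈ V, ∑ j ∈ V with j ≠ i ∧ N i j, μ.real (A i) * μ.real (A j)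
      ≤ μ.real (⋂ j ∈ V, (A j)ᶜ) ∧
    μ.real (⋂ j ∈ V, (A j)ᶜ) ≤ ∏ i ∈ V, (1 - μ.real (A i)) +
        ∑ i ∈ V, ∑ j ∈ V with j ≠ i ∧ N i j, μ.real (A i ∩ A j) := by
  induction V using Finset.induction_on with
  | empty => simp
  | insert a V ha ih =>
    obtain ⟨ih1, ih2⟩ := ih
    set R := ⋂ j ∈ V, (A j)ᶜ with hR
    set F := V.filter fun j => ¬ N a j with hF
    set RF := ⋂ j ∈ F, (A j)ᶜ with hRF
    set D := V.filter fun j => j ≠ a ∧ N a j with hD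
    have hsub : R ⊆ RF := by
      intro ω hω
      simp only [hRF, hR, Set.mem_iInter] at hω ⊢
      exact fun j hj => hω j (Finset.mem_filter.1 hj).1
    have hcover : RF ⊆ R ∪ ⋃ j ∈ D, A j := by
      intro ω hω
      by_cases h : ω ∈ R
      · exact Or.inl h
      · right
        simp only [hR, Set.mem_iInter, not_forall] at h
        obtain ⟨j, hj, hjA⟩ := h
        simp only [Set.mem_iUnion]
        refine ⟨j, ?_, by simpa using hjA⟩
        rw [hD, Finset.mem_filter]
        refine ⟨hj, fun h => ha (h ▸ hj), ?_⟩
        by_contra hN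
        simp only [hRF, Set.mem_iInter] at hω
        exact hjA (hω j (Finset.mem_filter.2 ⟨hj, hN⟩))
    have hindF : μ.real (A a ∩ RF) = μ.real (A a) * μ.real RF :=
      hind a F fun j hj => (Finset.mem_filter.1 hj).2
    have hins : (⋂ j ∈ insert a V, (A j)ᶜ) = R \ (A a ∩ R) := by
      rw [Finset.set_biInter_insert]
      ext ω; simp only [Set.mem_inter_iff, Set.mem_sdiff, Set.mem_compl_iff]; tauto
    have hval : μ.real (⋂ j ∈ insert a V, (A j)ᶜ) = μ.real R - μ.real (A a ∩ R) := by
      rw [hins, measureReal_sdiff Set.inter_subset_right .of_discrete]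
    have h1 : μ.real RF ≤ μ.real R + ∑ j ∈ D, μ.real (A j) :=
      (measureReal_mono hcover).trans ((measureReal_union_le _ _).trans
        (by gcongr; exact measureReal_biUnion_finset_le _ _))
    have h2 : μ.real (A a ∩ RF) ≤ μ.real (A a ∩ R) + ∑ j ∈ D, μ.real (A a ∩ A j) := by
      have : A a ∩ RF ⊆ (A a ∩ R) ∪ ⋃ j ∈ D, (A a ∩ A j) := by
        rintro ω ⟨h, h'⟩
        rcases hcover h' with h'' | h''
        · exact Or.inl ⟨h, h''⟩
        · right
          simp only [Set.mem_iUnion] at h'' ⊢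
          obtain ⟨j, hj, hA⟩ := h''
          exact ⟨j, hj, h, hA⟩
      exact (measureReal_mono this).trans ((measureReal_union_le _ _).trans
        (by gcongr; exact measureReal_biUnion_finset_le _ _))
    have h3 : μ.real (A a ∩ R) ≤ μ.real (A a ∩ RF) :=
      measureReal_mono (Set.inter_subset_inter_right _ hsub)
    have h4 : μ.real R ≤ μ.real RF := measureReal_mono hsub
    have p0 : 0 ≤ μ.real (A a) := measureReal_nonneg
    have p1 : μ.real (A a) ≤ 1 := measureReal_le_one
    have hmon : ∀ w : ι → ι → ℝ, (∀ i j, 0 ≤ w i j) →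
        ∑ j ∈ D, w a j + ∑ i ∈ V, ∑ j ∈ V with j ≠ i ∧ N i j, w i j ≤
        ∑ i ∈ insert a V, ∑ j ∈ insert a V with j ≠ i ∧ N i j, w i j := by
      intro w hw
      rw [Finset.sum_insert ha]
      gcongr with i hi
      · exact fun _ _ _ => hw a _
      · exact Finset.filter_subset_filter _ (Finset.subset_insert _ _)
      · exact fun _ _ _ => hw i _
      · exact Finset.subset_insert _ _
    have hm1 := hmon (fun i j => μ.real (A i) * μ.real (A j)) (fun i j => by positivity)
    have hm2 := hmon (fun i j => μ.real (A i ∩ A j)) (fun i j => by positivity)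
    have hb1 : 0 ≤ ∑ i ∈ V, ∑ j ∈ V with j ≠ i ∧ N i j, μ.real (A i) * μ.real (A j) :=
      Finset.sum_nonneg fun i _ => Finset.sum_nonneg fun j _ => by positivity
    have hb2 : 0 ≤ ∑ i ∈ V, ∑ j ∈ V with j ≠ i ∧ N i j, μ.real (A i ∩ A j) :=
      Finset.sum_nonneg fun i _ => Finset.sum_nonneg fun j _ => by positivity
    simp only [← Finset.mul_sum] at hm1
    rw [hval, Finset.prod_insert ha]
    simp only [← Finset.mul_sum] at ih1 hb1 ⊢
    constructor
    · nlinarith [mul_le_mul_of_nonneg_left h1 p0]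
    · nlinarith [mul_le_mul_of_nonneg_left h4 p0]

/-- Second moment bound for the probability that no event of a family occurs. -/
theorem prob_avoid_mul_sq_le [DecidableEq ι] (A : ι → Set Ω) (N : ι → ι → Prop)
    [DecidableRel N] (V : Finset ι)
    (hind : ∀ i j, ¬ N i j → μ.real (A i ∩ A j) = μ.real (A i) * μ.real (A j)) :
    μ.real (⋂ j ∈ V, (A j)ᶜ) * (∑ i ∈ V, μ.real (A i)) ^ 2 ≤
      ∑ i ∈ V, μ.real (A i) +
        ∑ i ∈ V, ∑ j ∈ V with j ≠ i ∧ N i j, μ.real (A i ∩ A j) := by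
  set L := ∑ i ∈ V, μ.real (A i) with hL
  set W : Ω → ℝ := fun ω => ∑ i ∈ V, (A i).indicator 1 ω with hW
  have hint : ∀ B : Set Ω, Integrable (B.indicator (1 : Ω → ℝ)) μ := fun B =>
    (integrable_indicator_iff .of_discrete).2 (integrable_const (1 : ℝ)).integrableOn
  have hI : ∀ B : Set Ω, ∫ ω, B.indicator (1 : Ω → ℝ) ω ∂μ = μ.real B := fun B =>
    integral_indicator_one .of_discrete
  have hWint : Integrable W μ := integrable_finsetSum _ fun i _ => hint _
  have hW2 : (fun ω => W ω ^ 2) = fun ω => ∑ i ∈ V, ∑ j ∈ V, (A i ∩ A j).indicator 1 ω := by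
    ext ω
    rw [hW, sq, Finset.sum_mul_sum]
    simp [Set.inter_indicator_one]
  have hW2int : Integrable (fun ω => W ω ^ 2) μ := by
    rw [hW2]
    exact integrable_finsetSum _ fun i _ => integrable_finsetSum _ fun j _ => hint _
  have hEW : ∫ ω, W ω ∂μ = L := by
    rw [hW, integral_finsetSum _ fun i _ => hint _]
    simp only [hI, hL]
  have hEW2 : ∫ ω, W ω ^ 2 ∂μ = ∑ i ∈ V, ∑ j ∈ V, μ.real (A i ∩ A j) := by
    rw [hW2, integral_finsetSum _ fun i _ => integrable_finsetSum _ fun j _ => hint _]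
    refine Finset.sum_congr rfl fun i _ => ?_
    rw [integral_finsetSum _ fun j _ => hint _]
    simp only [hI]
  have hle : ∫ ω, (⋂ j ∈ V, (A j)ᶜ).indicator (1 : Ω → ℝ) ω * L ^ 2 ∂μ ≤
      ∫ ω, (W ω ^ 2 - 2 * L * W ω + L ^ 2) ∂μ := by
    refine integral_mono ((hint _).mul_const _)
      ((hW2int.sub (hWint.const_mul _)).add (integrable_const _)) fun ω => ?_
    by_cases h : ω ∈ ⋂ j ∈ V, (A j)ᶜ
    · have : W ω = 0 := by
        rw [hW]
        refine Finset.sum_eq_zero fun i hi => ?_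
        simp only [Set.mem_iInter] at h
        exact Set.indicator_of_notMem (h i hi) _
      simp [Set.indicator_of_mem h, this]
    · simp only [Set.indicator_of_notMem h]
      nlinarith [sq_nonneg (W ω - L)]
  have hright : ∫ ω, (W ω ^ 2 - 2 * L * W ω + L ^ 2) ∂μ =
      ∫ ω, W ω ^ 2 ∂μ - 2 * L * ∫ ω, W ω ∂μ + L ^ 2 := by
    rw [← integral_const_mul, ← integral_sub hW2int (hWint.const_mul _)]
    refine (integral_add (hW2int.sub (hWint.const_mul _)) (integrable_const _)).trans ?_
    simp
  rw [integral_mul_const, hI, hright, hEW, hEW2] at hle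
  have hterm : ∀ i ∈ V, ∑ j ∈ V, μ.real (A i ∩ A j) ≤
      μ.real (A i) + ∑ j ∈ V with j ≠ i ∧ N i j, μ.real (A i ∩ A j) + μ.real (A i) * L := by
    intro i hi
    have : ∀ j ∈ V, μ.real (A i ∩ A j) ≤ (if j = i then μ.real (A i) else 0) +
        (if j ≠ i ∧ N i j then μ.real (A i ∩ A j) else 0) + μ.real (A i) * μ.real (A j) := by
      intro j _
      have hpp : 0 ≤ μ.real (A i) * μ.real (A j) := by positivity
      by_cases h1 : j = i
      · subst h1; simp only [Set.inter_self, if_true, ne_eq, not_true, false_and, if_false]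
        linarith
      · by_cases h2 : N i j
        · simp only [h1, h2, ne_eq, not_false_eq_true, and_self, if_true, if_false]; linarith
        · simp only [h1, h2, and_false, if_false, hind i j h2]; linarith
    refine (Finset.sum_le_sum this).trans (le_of_eq ?_)
    rw [Finset.sum_add_distrib, Finset.sum_add_distrib, Finset.sum_ite_eq' V i, if_pos hi,
      ← Finset.sum_filter, ← Finset.mul_sum]
  have hsum := Finset.sum_le_sum hterm
  rw [Finset.sum_add_distrib, Finset.sum_add_distrib, ← Finset.sum_mul, ← hL] at hsum
  nlinarith

end Abstract

instance : IsProbabilityMeasure (bernoulliBool (1 / 2)) := by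
  refine ⟨?_⟩
  simp only [bernoulliBool, Measure.add_apply, Measure.smul_apply, measure_univ,
    ENNReal.smul_def, smul_eq_mul, mul_one]
  norm_cast
  rw [← Real.toNNReal_add (by norm_num) (by norm_num)]
  norm_num

instance (n : ℕ) : IsProbabilityMeasure (erdosRenyi n (1 / 2)) := by
  unfold erdosRenyi; infer_instance

theorem bernoulliBool_half_singleton (b : Bool) :
    bernoulliBool (1 / 2) {b} = 2⁻¹ := by
  have h : ((1 / 2 : ℝ).toNNReal : ENNReal) = 2⁻¹ := by
    rw [show (1 / 2 : ℝ) = ((2⁻¹ : NNReal) : ℝ) by norm_num, Real.toNNReal_coe]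
    rw [ENNReal.coe_inv two_ne_zero]; rfl
  have h' : ((1 - 1 / 2 : ℝ).toNNReal : ENNReal) = 2⁻¹ := by
    rw [← h]; norm_num
  cases b <;>
    simp only [bernoulliBool, Measure.add_apply, Measure.smul_apply, ENNReal.smul_def, h, h',
      smul_eq_mul] <;> simp

section Cylinder

variable {κ : Type*}

/-- The event that the coins in `I` show the pattern `c`. -/
def cylinderEvent (I : Finset κ) (c : κ → Bool) : Set (κ → Bool) :=
  {ω | ∀ e ∈ I, ω e = c e}

theorem erdosRenyi_cylinderEvent {n : ℕ} (I : Finset (Sym2 (Fin n))) (c : Sym2 (Fin n) → Bool) :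
    (erdosRenyi n (1 / 2)).real (cylinderEvent I c) = (2 : ℝ)⁻¹ ^ I.card := by
  classical
  have : cylinderEvent I c =
      Set.univ.pi fun e => if e ∈ I then ({c e} : Set Bool) else Set.univ := by
    ext ω
    simp only [cylinderEvent, Set.mem_ofPred_eq, Set.mem_pi, Set.mem_univ, true_imp_iff]
    refine forall_congr' fun e => ?_
    by_cases h : e ∈ I <;> simp [h]
  rw [Measure.real, this, erdosRenyi, Measure.pi_pi]
  have h2 : ∀ e, bernoulliBool (1 / 2) (if e ∈ I then ({c e} : Set Bool) else Set.univ) =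
      if e ∈ I then 2⁻¹ else 1 := by
    intro e
    split_ifs
    · exact bernoulliBool_half_singleton _
    · exact measure_univ
  simp_rw [h2]
  rw [Finset.prod_ite_mem, Finset.univ_inter, Finset.prod_const]
  simp

theorem cylinderEvent_inter_eq_empty {I J : Finset κ} {c c' : κ → Bool} {e : κ}
    (hI : e ∈ I) (hJ : e ∈ J) (h : c e ≠ c' e) :
    cylinderEvent I c ∩ cylinderEvent J c' = ∅ := by
  ext ω
  simp only [cylinderEvent, Set.mem_inter_iff, Set.mem_ofPred_eq, Set.mem_empty_iff_false,
    iff_false, not_and]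
  exact fun h1 h2 => h ((h1 e hI).symm.trans (h2 e hJ))

theorem erdosRenyi_cylinderEvent_inter_le {n : ℕ} (I J : Finset (Sym2 (Fin n)))
    (c c' : Sym2 (Fin n) → Bool) :
    (erdosRenyi n (1 / 2)).real (cylinderEvent I c ∩ cylinderEvent J c') ≤
      (2 : ℝ)⁻¹ ^ (I ∪ J).card := by
  classical
  rw [← erdosRenyi_cylinderEvent (I ∪ J) fun e => if e ∈ I then c e else c' e]
  refine measureReal_mono ?_
  rintro ω ⟨h1, h2⟩ e he
  by_cases h : e ∈ I
  · simpa [h] using h1 e h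
  · simpa [h] using h2 e ((Finset.mem_union.1 he).resolve_left h)

theorem erdosRenyi_cylinderEvent_inter_avoid {n : ℕ} {ι : Type*} (I : Finset (Sym2 (Fin n)))
    (c : Sym2 (Fin n) → Bool) (F : Finset ι) (J : ι → Finset (Sym2 (Fin n)))
    (d : ι → Sym2 (Fin n) → Bool) (hdisj : ∀ j ∈ F, Disjoint I (J j)) :
    (erdosRenyi n (1 / 2)).real
        (cylinderEvent I c ∩ ⋂ j ∈ F, (cylinderEvent (J j) (d j))ᶜ) =
      (erdosRenyi n (1 / 2)).real (cylinderEvent I c) *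
        (erdosRenyi n (1 / 2)).real (⋂ j ∈ F, (cylinderEvent (J j) (d j))ᶜ) := by
  classical
  have hindep : iIndepFun (fun (e : Sym2 (Fin n)) (ω : Sym2 (Fin n) → Bool) => ω e)
      (erdosRenyi n (1 / 2)) :=
    iIndepFun_pi (X := fun _ => id) fun _ => aemeasurable_id
  have h := hindep.indepFun_finset I Iᶜ disjoint_compl_right fun e => measurable_pi_apply e
  have h1 : cylinderEvent I c = (fun (ω : Sym2 (Fin n) → Bool) (e : I) => ω e) ⁻¹'
      {x | ∀ e, x e = c e} := by
    ext ω; simp [cylinderEvent]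
  have h2 : (⋂ j ∈ F, (cylinderEvent (J j) (d j))ᶜ) =
      (fun (ω : Sym2 (Fin n) → Bool) (e : (Iᶜ : Finset _)) => ω e) ⁻¹'
      {x | ∀ j ∈ F, ¬ ∀ e : (Iᶜ : Finset _), e.1 ∈ J j → x e = d j e} := by
    ext ω
    simp only [cylinderEvent, Set.mem_iInter, Set.mem_compl_iff, Set.mem_ofPred_eq,
      Set.mem_preimage, Subtype.forall, Finset.mem_compl]
    refine forall₂_congr fun j hj => not_congr ⟨fun h e _ => h e, fun h e he => ?_⟩
    exact h e (Finset.disjoint_right.1 (hdisj j hj) he) he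
  rw [h1, h2]
  simp only [Measure.real]
  rw [h.measure_inter_preimage_eq_mul _ _ .of_discrete .of_discrete, ENNReal.toReal_mul]

end Cylinder

section

section InnerEdges

variable {V : Type*} [DecidableEq V]

/-- The unordered pairs of distinct elements of `S`. -/
def innerEdges (S : Finset V) : Finset (Sym2 V) :=
  S.offDiag.image Sym2.mk.uncurry

theorem mk_mem_innerEdges {S : Finset V} {u v : V} :
    s(u, v) ∈ innerEdges S ↔ u ∈ S ∧ v ∈ S ∧ u ≠ v := by
  simp only [innerEdges, Finset.mem_image, Finset.mem_offDiag, Prod.exists,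
    Function.uncurry_apply_pair, Sym2.eq_iff]
  constructor
  · rintro ⟨a, b, ⟨ha, hb, hab⟩, ⟨rfl, rfl⟩ | ⟨rfl, rfl⟩⟩
    · exact ⟨ha, hb, hab⟩
    · exact ⟨hb, ha, hab.symm⟩
  · exact fun h => ⟨u, v, h, Or.inl ⟨rfl, rfl⟩⟩

theorem card_innerEdges (S : Finset V) : (innerEdges S).card = S.card.choose 2 :=
  Sym2.card_image_offDiag S

theorem innerEdges_inter (S T : Finset V) :
    innerEdges S ∩ innerEdges T = innerEdges (S ∩ T) := by
  ext e
  induction e using Sym2.ind with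
  | _ u v => simp only [Finset.mem_inter, mk_mem_innerEdges]; tauto

theorem card_innerEdges_union (S T : Finset V) :
    (innerEdges S ∪ innerEdges T).card =
      S.card.choose 2 + T.card.choose 2 - (S ∩ T).card.choose 2 := by
  rw [Finset.card_union, innerEdges_inter]
  simp only [card_innerEdges]

theorem disjoint_innerEdges {S T : Finset V} (h : ¬ 2 ≤ (S ∩ T).card) :
    Disjoint (innerEdges S) (innerEdges T) := by
  rw [Finset.disjoint_iff_inter_eq_empty, innerEdges_inter, ← Finset.card_eq_zero,
    card_innerEdges, Nat.choose_eq_zero_of_lt (by omega)]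

/-- Whether a pair has exactly one element in `B`. -/
def crosses (B : Finset V) : Sym2 V → Bool :=
  Sym2.lift ⟨fun u v => xor (decide (u ∈ B)) (decide (v ∈ B)), fun _ _ => Bool.xor_comm _ _⟩

theorem crosses_mk (B : Finset V) (u v : V) :
    crosses B s(u, v) = xor (decide (u ∈ B)) (decide (v ∈ B)) := rfl

/-- The partitions induced by `B` on `S` and by `B'` on `T` agree on `S ∩ T`. -/
def Compatible (S B T B' : Finset V) : Prop :=
  ∀ u ∈ S ∩ T, ∀ v ∈ S ∩ T, ((u ∈ B ↔ v ∈ B) ↔ (u ∈ B' ↔ v ∈ B'))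

instance (S B T B' : Finset V) : Decidable (Compatible S B T B') := by
  unfold Compatible; infer_instance

theorem card_filter_compatible_le (S B T : Finset V) (h : (S ∩ T).Nonempty) :
    (T.powerset.filter fun B' => Compatible S B T B').card ≤ 2 * 2 ^ (T.card - (S ∩ T).card) := by
  obtain ⟨x, hx⟩ := h
  have hcard : ((T \ S).powerset ×ˢ (Finset.univ : Finset Bool)).card =
      2 * 2 ^ (T.card - (S ∩ T).card) := by
    rw [Finset.card_product, Finset.card_powerset, Finset.card_sdiff]
    simp [mul_comm]
  rw [← hcard]
  refine Finset.card_le_card_of_injOn (fun B' => (B' \ S, decide (x ∈ B'))) ?_ ?_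
  · intro B' hB'
    simp only [Finset.coe_filter, Set.mem_ofPred_eq, Finset.mem_powerset] at hB'
    simp only [Finset.coe_product, Set.mem_prod, Finset.mem_coe, Finset.mem_powerset,
      Finset.mem_univ, and_true]
    exact Finset.sdiff_subset_sdiff hB'.1 subset_rfl
  · intro B₁ h1 B₂ h2 heq
    simp only [Finset.coe_filter, Set.mem_ofPred_eq, Finset.mem_powerset] at h1 h2
    simp only [Prod.mk.injEq, decide_eq_decide] at heq
    ext v
    by_cases hvS : v ∈ S
    · by_cases hvT : v ∈ T
      · have hv : v ∈ S ∩ T := Finset.mem_inter.2 ⟨hvS, hvT⟩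
        have a1 := h1.2 x hx v hv
        have a2 := h2.2 x hx v hv
        tauto
      · exact ⟨fun h => absurd (h1.1 h) hvT, fun h => absurd (h2.1 h) hvT⟩
    · have := Finset.ext_iff.1 heq.1 v
      simpa [hvS] using this

end InnerEdges

variable {n : ℕ}

/-- The event that the graph induced on `i.1` is complete bipartite with classes
`i.2` and `i.1 \ i.2` (or empty, if one of the classes is). -/
def partEvent (i : Σ _ : Finset (Fin n), Finset (Fin n)) : Set (Sym2 (Fin n) → Bool) :=
  cylinderEvent (innerEdges i.1) (crosses i.2)

theorem prob_partEvent (i : Σ _ : Finset (Fin n), Finset (Fin n)) :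
    (erdosRenyi n (1 / 2)).real (partEvent i) = (2 : ℝ)⁻¹ ^ (i.1.card.choose 2) := by
  rw [partEvent, erdosRenyi_cylinderEvent, card_innerEdges]

theorem prob_partEvent_inter_le (i j : Σ _ : Finset (Fin n), Finset (Fin n)) :
    (erdosRenyi n (1 / 2)).real (partEvent i ∩ partEvent j) ≤
      if Compatible i.1 i.2 j.1 j.2 then
        (2 : ℝ)⁻¹ ^ (i.1.card.choose 2 + j.1.card.choose 2 - (i.1 ∩ j.1).card.choose 2)
      else 0 := by
  split_ifs with h
  · rw [← card_innerEdges_union]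
    exact erdosRenyi_cylinderEvent_inter_le _ _ _ _
  · simp only [Compatible, not_forall] at h
    obtain ⟨u, hu, v, hv, huv⟩ := h
    have hne : u ≠ v := by rintro rfl; simp at huv
    rw [Finset.mem_inter] at hu hv
    rw [partEvent, partEvent, cylinderEvent_inter_eq_empty (e := s(u, v))
      (mk_mem_innerEdges.2 ⟨hu.1, hv.1, hne⟩) (mk_mem_innerEdges.2 ⟨hu.2, hv.2, hne⟩) ?_]
    · simp
    · intro hc
      apply huv
      simp only [crosses_mk] at hc
      by_cases h1 : u ∈ i.2 <;> by_cases h2 : v ∈ i.2 <;> by_cases h3 : u ∈ j.2 <;>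
        by_cases h4 : v ∈ j.2 <;> simp_all

/-- The vertex sets of `i` and `j` share a pair of vertices. -/
def Overlap (i j : Σ _ : Finset (Fin n), Finset (Fin n)) : Prop :=
  2 ≤ (i.1 ∩ j.1).card

instance : DecidableRel (Overlap (n := n)) := fun i j => by
  unfold Overlap; infer_instance

theorem overlap_comm {i j : Σ _ : Finset (Fin n), Finset (Fin n)} : Overlap i j ↔ Overlap j i := by
  rw [Overlap, Overlap, Finset.inter_comm]

theorem prob_partEvent_inter_avoid (i : Σ _ : Finset (Fin n), Finset (Fin n))
    (F : Finset (Σ _ : Finset (Fin n), Finset (Fin n))) (hF : ∀ j ∈ F, ¬ Overlap i j) :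
    (erdosRenyi n (1 / 2)).real (partEvent i ∩ ⋂ j ∈ F, (partEvent j)ᶜ) =
      (erdosRenyi n (1 / 2)).real (partEvent i) *
        (erdosRenyi n (1 / 2)).real (⋂ j ∈ F, (partEvent j)ᶜ) :=
  erdosRenyi_cylinderEvent_inter_avoid _ _ F (fun j => innerEdges j.1) (fun j => crosses j.2)
    fun j hj => disjoint_innerEdges (hF j hj)

theorem prob_partEvent_inter_of_not_overlap (i j : Σ _ : Finset (Fin n), Finset (Fin n))
    (h : ¬ Overlap i j) :
    (erdosRenyi n (1 / 2)).real (partEvent i ∩ partEvent j) =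
      (erdosRenyi n (1 / 2)).real (partEvent i) * (erdosRenyi n (1 / 2)).real (partEvent j) := by
  have h1 := prob_partEvent_inter_avoid i {j} (by simpa using h)
  simp only [Finset.mem_singleton, Set.iInter_iInter_eq_left] at h1
  rw [probReal_compl_eq_one_sub .of_discrete] at h1
  have h2 := measureReal_inter_add_sdiff (μ := erdosRenyi n (1 / 2)) (s := partEvent i)
    (t := partEvent j) .of_discrete
  rw [Set.sdiff_eq] at h2
  linarith

/-- A rule choosing, for each vertex set, at most about `a ^ m` of the partitions of an
`m`-element set into two classes, each given by the class without the least vertex. -/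
structure IsPartRule (a : ℝ) (col : Finset (Fin n) → Finset (Finset (Fin n))) : Prop where
  subset : ∀ S, ∀ B ∈ col S, B ⊆ S
  min_notMem : ∀ S, ∀ B ∈ col S, ∀ x ∈ S, (∀ y ∈ S, x ≤ y) → x ∉ B
  card_le : ∀ S, ((col S).card : ℝ) ≤ a ^ S.card
  card_compatible_le : ∀ S B T, (S ∩ T).Nonempty →
    (((col T).filter fun B' => Compatible S B T B').card : ℝ) ≤
      2 * a ^ (T.card - (S ∩ T).card)

/-- All pairs of an `m`-element set of vertices and one of its partitions allowed by `col`. -/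
def parts (col : Finset (Fin n) → Finset (Finset (Fin n))) (m : ℕ) :
    Finset (Σ _ : Finset (Fin n), Finset (Fin n)) :=
  (Finset.univ.powersetCard m).sigma col

theorem mem_parts {col : Finset (Fin n) → Finset (Finset (Fin n))} {m : ℕ}
    {i : Σ _ : Finset (Fin n), Finset (Fin n)} :
    i ∈ parts col m ↔ i.1.card = m ∧ i.2 ∈ col i.1 := by
  simp [parts, Finset.mem_powersetCard]

theorem eq_of_compatible {a : ℝ} {col : Finset (Fin n) → Finset (Finset (Fin n))}
    (hcol : IsPartRule a col) {S B B' : Finset (Fin n)} (hS : S.Nonempty) (hB : B ∈ col S)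
    (hB' : B' ∈ col S) (h : Compatible S B S B') : B = B' := by
  have hm := S.min'_mem hS
  have h1 := hcol.min_notMem S B hB _ hm fun y hy => S.min'_le y hy
  have h2 := hcol.min_notMem S B' hB' _ hm fun y hy => S.min'_le y hy
  ext v
  by_cases hv : v ∈ S
  · have := h (S.min' hS) (by simpa using hm) v (by simpa using hv)
    tauto
  · exact ⟨fun h => absurd (hcol.subset S B hB h) hv, fun h => absurd (hcol.subset S B' hB' h) hv⟩

theorem card_filter_le_inter_le {V : Type*} [DecidableEq V] [Fintype V] (S : Finset V)
    (m l : ℕ) :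
    ((Finset.univ.powersetCard m).filter fun T => l ≤ (S ∩ T).card).card ≤
      S.card.choose l * (Fintype.card V - l).choose (m - l) := by
  have hsub : ((Finset.univ.powersetCard m).filter fun T => l ≤ (S ∩ T).card) ⊆
      (S.powersetCard l).biUnion fun P => (Finset.univ.powersetCard m).filter (P ⊆ ·) := by
    intro T hT
    rw [Finset.mem_filter] at hT
    obtain ⟨P, hP, hc⟩ := Finset.exists_subset_card_eq hT.2
    rw [Finset.mem_biUnion]
    exact ⟨P, Finset.mem_powersetCard.2 ⟨hP.trans Finset.inter_subset_left, hc⟩,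
      Finset.mem_filter.2 ⟨hT.1, hP.trans Finset.inter_subset_right⟩⟩
  refine (Finset.card_le_card hsub).trans ?_
  rw [← Finset.card_powersetCard]
  refine Finset.card_biUnion_le_card_mul _ _ _ fun P hP => ?_
  rw [Finset.mem_powersetCard] at hP
  by_cases hm : l ≤ m
  · rw [Finset.filter_powersetCard_subset _ _ _ (Finset.subset_univ _) (hP.2.trans_le hm)]
    refine Finset.card_image_le.trans ?_
    rw [Finset.card_powersetCard, Finset.card_sdiff, Finset.inter_univ, Finset.card_univ, hP.2]
  · rw [Finset.card_eq_zero.2]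
    · exact Nat.zero_le _
    · rw [Finset.filter_eq_empty_iff]
      intro T hT hPT
      have := Finset.card_le_card hPT
      rw [Finset.mem_powersetCard] at hT
      omega

end

section

theorem f_eq (n k : ℕ) : f n k = n.choose k * (2 : ℝ)⁻¹ ^ (k.choose 2) := by
  rw [f, zpow_neg, zpow_natCast, inv_pow]

theorem f_nonneg (n k : ℕ) : 0 ≤ f n k := by rw [f_eq]; positivity

theorem f_pos {n k : ℕ} (h : k ≤ n) : 0 < f n k := by
  have := Nat.choose_pos h
  rw [f_eq]; positivity

/-- `a ^ m` times the expected number of independent sets of size `m`. -/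
noncomputable def weightedF (a : ℝ) (n m : ℕ) : ℝ := a ^ m * f n m

theorem weightedF_nonneg {a : ℝ} (ha : 0 ≤ a) (n m : ℕ) : 0 ≤ weightedF a n m :=
  mul_nonneg (pow_nonneg ha m) (f_nonneg n m)

theorem weightedF_pos {a : ℝ} (ha : 0 < a) {n m : ℕ} (h : m ≤ n) : 0 < weightedF a n m :=
  mul_pos (pow_pos ha m) (f_pos h)

/-- The relative contribution of overlapping pairs of `m`-element sets to the second moment. -/
noncomputable def overlapSum (a : ℝ) (n m : ℕ) : ℝ :=
  ∑ l ∈ Finset.Ico 2 m, (m.choose l : ℝ) ^ 2 / weightedF a n l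

variable {n : ℕ} {a : ℝ} {col : Finset (Fin n) → Finset (Finset (Fin n))}

theorem card_parts_le (hcol : IsPartRule a col) (m : ℕ) :
    ((parts col m).card : ℝ) ≤ a ^ m * n.choose m := by
  rw [parts, Finset.card_sigma, Nat.cast_sum]
  refine (Finset.sum_le_card_nsmul _ _ (a ^ m) fun S hS => ?_).trans (le_of_eq ?_)
  · rw [← (Finset.mem_powersetCard.1 hS).2]; exact hcol.card_le S
  · rw [Finset.card_powersetCard, Finset.card_univ, Fintype.card_fin, nsmul_eq_mul, mul_comm]

theorem sum_prob_parts_eq (m : ℕ) :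
    ∑ i ∈ parts col m, (erdosRenyi n (1 / 2)).real (partEvent i) =
      (parts col m).card * (2 : ℝ)⁻¹ ^ (m.choose 2) := by
  rw [Finset.sum_congr rfl fun i hi => by rw [prob_partEvent, (mem_parts.1 hi).1],
    Finset.sum_const, nsmul_eq_mul]

theorem sum_prob_parts_le (hcol : IsPartRule a col) (m : ℕ) :
    ∑ i ∈ parts col m, (erdosRenyi n (1 / 2)).real (partEvent i) ≤ weightedF a n m := by
  rw [sum_prob_parts_eq, weightedF, f_eq, ← mul_assoc]
  gcongr
  exact card_parts_le hcol m

theorem choose_sub_mul_choose {n m l : ℕ} (hl : l ≤ m) (hm : m ≤ n) :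
    ((n - l).choose (m - l) : ℝ) = n.choose m * m.choose l / n.choose l := by
  have h := Nat.choose_mul (n := n) hl
  have hp : (0 : ℝ) < n.choose l := by exact_mod_cast Nat.choose_pos (hl.trans hm)
  rw [eq_div_iff hp.ne']
  have : ((n.choose m * m.choose l : ℕ) : ℝ) = (n.choose l * (n - l).choose (m - l) : ℕ) := by
    rw [h]
  push_cast at this
  linarith

theorem sum_prob_inter_overlap_le (ha : 0 < a) (hcol : IsPartRule a col)
    {i : Σ _ : Finset (Fin n), Finset (Fin n)} {m : ℕ} (hm : m ≤ n)
    (hi : i.1.card < m ∨ i ∈ parts col m) :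
    ∑ j ∈ parts col m with j ≠ i ∧ Overlap i j,
        (erdosRenyi n (1 / 2)).real (partEvent i ∩ partEvent j) ≤
      2 * weightedF a n m * overlapSum a n m * (erdosRenyi n (1 / 2)).real (partEvent i) := by
  obtain ⟨S, B⟩ := i
  set s := S.card with hs
  have hsm : s ≤ m := by
    rcases hi with h | h
    · exact h.le
    · exact (mem_parts.1 h).1.le
  set w : ℕ → ℝ := fun l => 2 * a ^ (m - l) * (2 : ℝ)⁻¹ ^ (s.choose 2 + m.choose 2 - l.choose 2)
    with hw
  have hw0 : ∀ l, 0 ≤ w l := fun l => by simp only [hw]; positivity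
  have hT : ∀ T ∈ (Finset.univ : Finset (Fin n)).powersetCard m,
      (∑ B' ∈ col T, if (⟨T, B'⟩ : Σ _ : Finset (Fin n), Finset (Fin n)) ≠ ⟨S, B⟩ ∧
        Overlap ⟨S, B⟩ ⟨T, B'⟩ then
          (erdosRenyi n (1 / 2)).real (partEvent ⟨S, B⟩ ∩ partEvent ⟨T, B'⟩) else 0) ≤
      ∑ l ∈ Finset.Ico 2 m, if l ≤ (S ∩ T).card then (if l = (S ∩ T).card then w l else 0)
        else 0 := by
    intro T hT
    rw [Finset.mem_powersetCard] at hT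
    set l := (S ∩ T).card with hl
    have hlm : l ≤ m := hT.2 ▸ Finset.card_le_card Finset.inter_subset_right
    have hls : l ≤ s := Finset.card_le_card Finset.inter_subset_left
    have hr : (∑ k ∈ Finset.Ico 2 m, if k ≤ l then (if k = l then w k else 0) else 0) =
        if 2 ≤ l ∧ l < m then w l else 0 := by
      rw [if_congr Finset.mem_Ico.symm rfl rfl, ← Finset.sum_ite_eq']
      refine Finset.sum_congr rfl fun k _ => ?_
      split_ifs <;> first | rfl | omega
    rw [hr]
    by_cases h2 : 2 ≤ l
    swap
    · rw [if_neg (fun h => h2 h.1)]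
      refine (Finset.sum_eq_zero fun B' _ => if_neg ?_).le
      exact fun h => h2 h.2
    by_cases hlt : l < m
    · rw [if_pos ⟨h2, hlt⟩]
      have hne : (S ∩ T).Nonempty := Finset.card_pos.1 (by omega)
      have : ∀ B' ∈ col T, (if (⟨T, B'⟩ : Σ _ : Finset (Fin n), Finset (Fin n)) ≠ ⟨S, B⟩ ∧
          Overlap ⟨S, B⟩ ⟨T, B'⟩ then
          (erdosRenyi n (1 / 2)).real (partEvent ⟨S, B⟩ ∩ partEvent ⟨T, B'⟩) else 0) ≤
          if Compatible S B T B' then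
            (2 : ℝ)⁻¹ ^ (s.choose 2 + m.choose 2 - l.choose 2) else 0 := by
        intro B' _
        refine le_trans ?_ ((prob_partEvent_inter_le ⟨S, B⟩ ⟨T, B'⟩).trans_eq ?_)
        · split_ifs
          · exact le_rfl
          · exact measureReal_nonneg
        · simp only [hT.2, hs, hl]
      refine (Finset.sum_le_sum this).trans ?_
      rw [← Finset.sum_filter, Finset.sum_const, nsmul_eq_mul]
      have hc := hcol.card_compatible_le S B T hne
      rw [hT.2] at hc
      simp only [hw]
      gcongr
    · have hlm' : l = m := by omega
      have hST : T = S := by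
        have h1 : S ∩ T = T :=
          Finset.eq_of_subset_of_card_le Finset.inter_subset_right (by omega)
        have h2 : S ∩ T = S :=
          Finset.eq_of_subset_of_card_le Finset.inter_subset_left (by omega)
        exact h1.symm.trans h2
      subst hST
      have hmem : B ∈ col T := by
        rcases hi with h | h
        · exact absurd h (by change ¬ T.card < m; omega)
        · exact (mem_parts.1 h).2
      rw [if_neg (fun h => hlt h.2)]
      refine Finset.sum_nonpos fun B' hB' => ?_
      split_ifs with h
      · refine (prob_partEvent_inter_le _ _).trans (le_of_eq (if_neg fun hc => h.1 ?_))
        have := eq_of_compatible hcol (Finset.card_pos.1 (by omega)) hmem hB' hc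
        rw [this]
      · exact le_rfl
  rw [Finset.sum_filter, parts, Finset.sum_sigma]
  refine (Finset.sum_le_sum hT).trans ?_
  rw [Finset.sum_comm, prob_partEvent, overlapSum, Finset.mul_sum, Finset.sum_mul]
  refine Finset.sum_le_sum fun l hl => ?_
  rw [Finset.mem_Ico] at hl
  rw [← Finset.sum_filter]
  refine (Finset.sum_le_card_nsmul _ _ (w l) fun T _ => ?_).trans ?_
  · split_ifs
    · exact le_rfl
    · exact hw0 l
  rw [nsmul_eq_mul]
  have hcard : ((((Finset.univ : Finset (Fin n)).powersetCard m).filter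
      fun T => l ≤ (S ∩ T).card).card : ℝ) ≤ m.choose l * (n - l).choose (m - l) := by
    have := card_filter_le_inter_le S m l
    rw [Fintype.card_fin] at this
    refine (Nat.cast_le (α := ℝ).2 this).trans ?_
    push_cast
    gcongr
  refine (mul_le_mul_of_nonneg_right hcard (hw0 l)).trans ?_
  rw [choose_sub_mul_choose hl.2.le hm]
  have hcl : l.choose 2 ≤ m.choose 2 := Nat.choose_le_choose 2 hl.2.le
  have e1 : (2 : ℝ)⁻¹ ^ (s.choose 2 + m.choose 2 - l.choose 2) =
      (2 : ℝ)⁻¹ ^ s.choose 2 * (2 : ℝ)⁻¹ ^ m.choose 2 / (2 : ℝ)⁻¹ ^ l.choose 2 := by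
    rw [eq_div_iff (by positivity), ← pow_add, ← pow_add]
    congr 1; omega
  have e2 : a ^ (m - l) = a ^ m / a ^ l := by
    rw [eq_div_iff (by positivity), ← pow_add]
    congr 1; omega
  have e3 : (0 : ℝ) < n.choose l := by exact_mod_cast Nat.choose_pos (hl.2.le.trans hm)
  simp only [hw, weightedF, f_eq]
  rw [e1, e2]
  refine le_of_eq ?_
  field_simp
  rw [hs]

theorem sum_prob_mul_overlap_le (ha : 0 < a) (hcol : IsPartRule a col)
    (i : Σ _ : Finset (Fin n), Finset (Fin n)) {m : ℕ} (hm2 : 2 ≤ m) (hm : m ≤ n) :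
    ∑ j ∈ parts col m with j ≠ i ∧ Overlap i j,
        (erdosRenyi n (1 / 2)).real (partEvent i) * (erdosRenyi n (1 / 2)).real (partEvent j) ≤
      (i.1.card.choose 2 * m.choose 2 / n.choose 2) * weightedF a n m *
        (erdosRenyi n (1 / 2)).real (partEvent i) := by
  have h1 : ∀ T ∈ (Finset.univ : Finset (Fin n)).powersetCard m,
      (∑ B' ∈ col T, if (⟨T, B'⟩ : Σ _ : Finset (Fin n), Finset (Fin n)) ≠ i ∧
        Overlap i ⟨T, B'⟩ then (erdosRenyi n (1 / 2)).real (partEvent ⟨T, B'⟩) else 0) ≤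
      if 2 ≤ (i.1 ∩ T).card then a ^ m * (2 : ℝ)⁻¹ ^ (m.choose 2) else 0 := by
    intro T hT
    rw [Finset.mem_powersetCard] at hT
    split_ifs with h
    · have : ∀ B' ∈ col T, (if (⟨T, B'⟩ : Σ _ : Finset (Fin n), Finset (Fin n)) ≠ i ∧
        Overlap i ⟨T, B'⟩ then (erdosRenyi n (1 / 2)).real (partEvent ⟨T, B'⟩) else 0) ≤
        (2 : ℝ)⁻¹ ^ (m.choose 2) := by
        intro B' _
        split_ifs
        · rw [prob_partEvent, hT.2]
        · positivity
      refine (Finset.sum_le_card_nsmul _ _ _ this).trans ?_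
      rw [nsmul_eq_mul]
      gcongr
      rw [← hT.2]; exact hcol.card_le T
    · exact (Finset.sum_eq_zero fun B' _ => if_neg fun h' => h h'.2).le
  rw [← Finset.mul_sum, mul_comm]
  refine mul_le_mul_of_nonneg_right ?_ measureReal_nonneg
  rw [Finset.sum_filter, parts, Finset.sum_sigma]
  refine (Finset.sum_le_sum h1).trans ?_
  rw [← Finset.sum_filter, Finset.sum_const, nsmul_eq_mul]
  have hcard := card_filter_le_inter_le i.1 m 2
  rw [Fintype.card_fin] at hcard
  have hcard' : ((((Finset.univ : Finset (Fin n)).powersetCard m).filter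
      fun T => 2 ≤ (i.1 ∩ T).card).card : ℝ) ≤
      i.1.card.choose 2 * (n - 2).choose (m - 2) := by exact_mod_cast hcard
  refine (mul_le_mul_of_nonneg_right hcard' (by positivity)).trans (le_of_eq ?_)
  rw [choose_sub_mul_choose hm2 hm, weightedF, f_eq]
  ring

end

section

variable {n : ℕ}

/-- Only the trivial partition. -/
def emptyPart (_ : Finset (Fin n)) : Finset (Finset (Fin n)) := {∅}

/-- All partitions into two nonempty classes. -/
def properParts (S : Finset (Fin n)) : Finset (Finset (Fin n)) :=
  (S.filter fun x => ∃ y ∈ S, y < x).powerset.erase ∅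

theorem isPartRule_emptyPart : IsPartRule 1 (emptyPart (n := n)) where
  subset S B hB := by rw [Finset.mem_singleton.1 hB]; exact Finset.empty_subset S
  min_notMem S B hB x _ _ := by rw [Finset.mem_singleton.1 hB]; simp
  card_le S := by simp [emptyPart]
  card_compatible_le S B T _ := by
    have h := Finset.card_filter_le (emptyPart T) fun B' => Compatible S B T B'
    have h' : (emptyPart T).card = 1 := rfl
    rw [one_pow]
    have : ((emptyPart T).filter fun B' => Compatible S B T B').card ≤ 2 := by omega
    exact_mod_cast this

theorem mem_properParts {S B : Finset (Fin n)} :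
    B ∈ properParts S ↔ B.Nonempty ∧ ∀ x ∈ B, x ∈ S ∧ ∃ y ∈ S, y < x := by
  simp [properParts, Finset.subset_iff, Finset.nonempty_iff_ne_empty]

theorem isPartRule_properParts : IsPartRule 2 (properParts (n := n)) where
  subset S B hB x hx := ((mem_properParts.1 hB).2 x hx).1
  min_notMem S B hB x _ hmin hx := by
    obtain ⟨y, hy, hlt⟩ := ((mem_properParts.1 hB).2 x hx).2
    exact absurd (hmin y hy) (not_le.2 hlt)
  card_le S := by
    have h1 : (properParts S).card ≤ 2 ^ S.card := by
      refine (Finset.card_le_card (Finset.erase_subset _ _)).trans ?_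
      rw [Finset.card_powerset]
      exact Nat.pow_le_pow_right two_pos (Finset.card_filter_le _ _)
    exact_mod_cast h1
  card_compatible_le S B T h := by
    have h1 : ((properParts T).filter fun B' => Compatible S B T B').card ≤
        2 * 2 ^ (T.card - (S ∩ T).card) := by
      refine le_trans (Finset.card_le_card (Finset.filter_subset_filter _ ?_))
        (card_filter_compatible_le S B T h)
      intro B' hB'
      exact Finset.mem_powerset.2 fun x hx => ((mem_properParts.1 hB').2 x hx).1
    exact_mod_cast h1

theorem two_pow_le_card_properParts {S : Finset (Fin n)} (h : 2 ≤ S.card) :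
    2 ^ S.card ≤ 4 * (properParts S).card := by
  have hne : S.Nonempty := Finset.card_pos.1 (by omega)
  have h1 : (S.filter fun x => ∃ y ∈ S, y < x) = S.erase (S.min' hne) := by
    ext x
    rw [Finset.mem_filter, Finset.mem_erase, and_comm]
    refine and_congr_left fun hx => ⟨?_, fun hx' => ?_⟩
    · rintro ⟨y, hy, hlt⟩ rfl
      exact absurd (S.min'_le y hy) (not_le.2 hlt)
    · exact ⟨_, S.min'_mem hne, lt_of_le_of_ne (S.min'_le x hx) (Ne.symm hx')⟩
  rw [properParts, h1, Finset.card_erase_of_mem (Finset.empty_mem_powerset _),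
    Finset.card_powerset, Finset.card_erase_of_mem (S.min'_mem hne)]
  obtain ⟨k, hk⟩ := Nat.exists_eq_add_of_le h
  rw [hk, show 2 + k - 1 = k + 1 by omega, pow_add, pow_succ]
  have := Nat.one_le_two_pow (n := k)
  omega

theorem card_parts_emptyPart (m : ℕ) : (parts (emptyPart (n := n)) m).card = n.choose m := by
  simp [parts, emptyPart, Finset.card_sigma]

theorem le_card_parts_properParts {m : ℕ} (h : 2 ≤ m) :
    2 ^ m * n.choose m ≤ 4 * (parts (properParts (n := n)) m).card := by
  rw [parts, Finset.card_sigma, Finset.mul_sum]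
  have : ∀ S ∈ (Finset.univ : Finset (Fin n)).powersetCard m, 2 ^ m ≤ 4 * (properParts S).card := by
    intro S hS
    rw [Finset.mem_powersetCard] at hS
    have := two_pow_le_card_properParts (S := S) (hS.2.symm ▸ h)
    rwa [hS.2] at this
  refine le_trans (le_of_eq ?_) (Finset.card_nsmul_le_sum _ _ _ this)
  rw [Finset.card_powersetCard, Finset.card_univ, Fintype.card_fin, smul_eq_mul, mul_comm]

theorem disjoint_parts (k m : ℕ) :
    Disjoint (parts (emptyPart (n := n)) k) (parts properParts m) := by
  rw [Finset.disjoint_left]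
  intro i hi hi'
  have h1 := Finset.mem_singleton.1 (mem_parts.1 hi).2
  have h2 := (mem_properParts.1 (mem_parts.1 hi').2).1
  rw [h1] at h2
  simp at h2

theorem graphOf_adj {ω : Sym2 (Fin n) → Bool} {u v : Fin n} :
    (graphOf n ω).Adj u v ↔ ω s(u, v) = true ∧ u ≠ v := by
  simp [graphOf]

theorem mem_partEvent {ω : Sym2 (Fin n) → Bool} {S B : Finset (Fin n)} :
    ω ∈ partEvent ⟨S, B⟩ ↔
      ∀ u ∈ S, ∀ v ∈ S, ((graphOf n ω).Adj u v ↔ ¬ (u ∈ B ↔ v ∈ B)) := by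
  have hx : ∀ u v : Fin n, crosses B s(u, v) = true ↔ ¬ (u ∈ B ↔ v ∈ B) := by
    intro u v
    rw [crosses_mk]
    by_cases h1 : u ∈ B <;> by_cases h2 : v ∈ B <;> simp [h1, h2]
  simp only [partEvent, cylinderEvent, Set.mem_ofPred_eq, graphOf_adj]
  constructor
  · intro h u hu v hv
    by_cases huv : u = v
    · subst huv; simp
    · rw [h _ (mk_mem_innerEdges.2 ⟨hu, hv, huv⟩), hx]; simp [huv]
  · intro h e
    induction e using Sym2.ind with
    | _ u v =>
      intro he
      obtain ⟨hu, hv, huv⟩ := mk_mem_innerEdges.1 he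
      have := h u hu v hv
      rw [← hx] at this
      rw [Bool.eq_iff_iff]
      simpa [huv] using this

theorem mem_avoid_iff {ω : Sym2 (Fin n) → Bool}
    {col : Finset (Fin n) → Finset (Finset (Fin n))} {m : ℕ} :
    ω ∈ (⋂ i ∈ parts col m, (partEvent i)ᶜ) ↔
      ∀ S : Finset (Fin n), S.card = m → ∀ B ∈ col S, ω ∉ partEvent ⟨S, B⟩ := by
  simp only [Set.mem_iInter, Set.mem_compl_iff, mem_parts, Sigma.forall, and_imp]
  exact ⟨fun h S hS B hB => h S B hS hB, fun h S B hS hB => h S hS B hB⟩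

theorem le_alpha_iff {V : Type*} [Fintype V] (G : SimpleGraph V) {k : ℕ} :
    k ≤ alpha G ↔ ∃ S : Finset V, S.card = k ∧ IsIndepFinset G S := by
  have hbdd : BddAbove {k | ∃ S : Finset V, S.card = k ∧ IsIndepFinset G S} := by
    refine ⟨Fintype.card V, ?_⟩
    rintro _ ⟨S, rfl, -⟩
    exact Finset.card_le_univ S
  constructor
  · intro h
    obtain ⟨S, hS, hind⟩ := Nat.sSup_mem (s := {k | ∃ S : Finset V, S.card = k ∧ IsIndepFinset G S})
      ⟨0, ∅, rfl, fun a ha => by simp at ha⟩ hbdd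
    obtain ⟨T, hT, hc⟩ := Finset.exists_subset_card_eq (h.trans hS.ge)
    exact ⟨T, hc, fun a ha b hb => hind a (hT ha) b (hT hb)⟩
  · exact fun h => le_csSup hbdd h

theorem mem_avoid_emptyPart_iff {ω : Sym2 (Fin n) → Bool} {k : ℕ} :
    ω ∈ (⋂ i ∈ parts emptyPart k, (partEvent i)ᶜ) ↔ alpha (graphOf n ω) < k := by
  rw [mem_avoid_iff, ← not_le, le_alpha_iff]
  push Not
  refine forall₂_congr fun S hS => ?_
  simp only [emptyPart, Finset.mem_singleton, forall_eq, mem_partEvent]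
  simp [IsIndepFinset]

theorem isInducedCompleteBipartite_of_mem_partEvent {ω : Sym2 (Fin n) → Bool}
    {S B : Finset (Fin n)} (hB : B ∈ properParts S) (hω : ω ∈ partEvent ⟨S, B⟩) :
    IsInducedCompleteBipartite (graphOf n ω) S B (S \ B) := by
  rw [mem_properParts] at hB
  have hBS : B ⊆ S := fun x hx => (hB.2 x hx).1
  rw [mem_partEvent] at hω
  refine ⟨hB.1, ?_, Finset.disjoint_sdiff, ?_, ?_⟩
  · obtain ⟨x, hx⟩ := hB.1
    have hne : S.Nonempty := ⟨x, hBS hx⟩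
    refine ⟨S.min' hne, Finset.mem_sdiff.2 ⟨S.min'_mem hne, fun hm => ?_⟩⟩
    obtain ⟨y, hy, hlt⟩ := (hB.2 _ hm).2
    exact absurd (S.min'_le y hy) (not_le.2 hlt)
  · rw [← Finset.coe_union, Finset.union_sdiff_of_subset hBS]
  · intro u hu v hv
    rw [hω u hu v hv]
    simp only [Finset.mem_sdiff, hu, hv, true_and]
    tauto

theorem exists_mem_partEvent {ω : Sym2 (Fin n) → Bool} {S A B : Finset (Fin n)}
    (h : IsInducedCompleteBipartite (graphOf n ω) S A B) :
    ∃ C ∈ properParts S, ω ∈ partEvent ⟨S, C⟩ := by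
  obtain ⟨hA, hB, hdisj, hun, hadj⟩ := h
  have hS : ∀ x, x ∈ S ↔ x ∈ A ∨ x ∈ B := by
    intro x
    have := Set.ext_iff.1 hun x
    simpa using this.symm
  have hAB : ∀ x, x ∈ A → x ∉ B := fun x hx => Finset.disjoint_left.1 hdisj hx
  have hne : S.Nonempty := by obtain ⟨x, hx⟩ := hA; exact ⟨x, (hS x).2 (Or.inl hx)⟩
  have hmin := S.min'_mem hne
  have hlt : ∀ x ∈ S, x ≠ S.min' hne → ∃ y ∈ S, y < x := fun x hx hxm =>
    ⟨_, hmin, lt_of_le_of_ne (S.min'_le x hx) (Ne.symm hxm)⟩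
  by_cases hm : S.min' hne ∈ A
  · refine ⟨B, mem_properParts.2 ⟨hB, fun x hx => ?_⟩, mem_partEvent.2 fun u hu v hv => ?_⟩
    · have hxS := (hS x).2 (Or.inr hx)
      exact ⟨hxS, hlt x hxS fun h => hAB _ hm (h ▸ hx)⟩
    · rw [hadj u hu v hv]
      have h1 := (hS u).1 hu
      have h2 := (hS v).1 hv
      have h3 := hAB u
      have h4 := hAB v
      tauto
  · refine ⟨A, mem_properParts.2 ⟨hA, fun x hx => ?_⟩, mem_partEvent.2 fun u hu v hv => ?_⟩
    · have hxS := (hS x).2 (Or.inl hx)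
      exact ⟨hxS, hlt x hxS fun h => hm (h ▸ hx)⟩
    · rw [hadj u hu v hv]
      have h1 := (hS u).1 hu
      have h2 := (hS v).1 hv
      have h3 := hAB u
      have h4 := hAB v
      tauto

theorem exists_isInducedCompleteBipartite_card_eq {V : Type*} [DecidableEq V] {G : SimpleGraph V}
    {S A B : Finset V} (h : IsInducedCompleteBipartite G S A B) {k : ℕ} (hk : 2 ≤ k)
    (hkS : k ≤ S.card) :
    ∃ S' A' B' : Finset V, IsInducedCompleteBipartite G S' A' B' ∧ S'.card = k := by
  obtain ⟨⟨a, ha⟩, ⟨b, hb⟩, hdisj, hun, hadj⟩ := h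
  have hS : ∀ x, x ∈ S ↔ x ∈ A ∨ x ∈ B := by
    intro x
    have := Set.ext_iff.1 hun x
    simpa using this.symm
  have hab : ({a, b} : Finset V) ⊆ S := by
    intro x hx
    rw [Finset.mem_insert, Finset.mem_singleton] at hx
    rcases hx with rfl | rfl
    · exact (hS _).2 (Or.inl ha)
    · exact (hS _).2 (Or.inr hb)
  obtain ⟨T, h1, h2, h3⟩ := Finset.exists_subsuperset_card_eq hab (Finset.card_le_two.trans hk) hkS
  refine ⟨T, A ∩ T, B ∩ T, ⟨⟨a, ?_⟩, ⟨b, ?_⟩, ?_, ?_, ?_⟩, h3⟩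
  · exact Finset.mem_inter.2 ⟨ha, h1 (by simp)⟩
  · exact Finset.mem_inter.2 ⟨hb, h1 (by simp)⟩
  · exact hdisj.mono Finset.inter_subset_left Finset.inter_subset_left
  · ext x
    simp only [Finset.coe_inter, Set.mem_union, Set.mem_inter_iff, Finset.mem_coe]
    have := hS x
    have := @h2 x
    tauto
  · intro u hu v hv
    rw [hadj u (h2 hu) v (h2 hv)]
    simp [hu, hv]

theorem le_beta_iff {V : Type*} [Fintype V] [DecidableEq V] (G : SimpleGraph V) {k : ℕ}
    (hk : 2 ≤ k) :
    k ≤ beta G ↔ ∃ S A B : Finset V, IsInducedCompleteBipartite G S A B ∧ S.card = k := by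
  have hbdd : BddAbove {k | ∃ S A B : Finset V, IsInducedCompleteBipartite G S A B ∧
      S.card = k} := by
    refine ⟨Fintype.card V, ?_⟩
    rintro _ ⟨S, A, B, -, rfl⟩
    exact Finset.card_le_univ S
  constructor
  · intro h
    have hne : {k | ∃ S A B : Finset V, IsInducedCompleteBipartite G S A B ∧
        S.card = k}.Nonempty := by
      by_contra hempty
      rw [Set.not_nonempty_iff_eq_empty] at hempty
      rw [beta, hempty, csSup_empty] at h
      simp at h
      omega
    obtain ⟨S, A, B, hind, hS⟩ := Nat.sSup_mem hne hbdd
    exact exists_isInducedCompleteBipartite_card_eq hind hk (h.trans hS.ge)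
  · exact fun h => le_csSup hbdd h

theorem mem_avoid_properParts_iff {ω : Sym2 (Fin n) → Bool} {k : ℕ} (hk : 2 ≤ k) :
    ω ∈ (⋂ i ∈ parts properParts k, (partEvent i)ᶜ) ↔ beta (graphOf n ω) < k := by
  rw [mem_avoid_iff, ← not_le, le_beta_iff _ hk]
  constructor
  · rintro h ⟨S, A, B, hind, hS⟩
    obtain ⟨C, hC, hω⟩ := exists_mem_partEvent hind
    exact h S hS C hC hω
  · exact fun h S hS B hB hω => h ⟨S, B, S \ B,
      isInducedCompleteBipartite_of_mem_partEvent hB hω, hS⟩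

end

theorem div_pow_le_choose {n k : ℕ} (hk : k ≤ n) : (n / k : ℝ) ^ k ≤ n.choose k := by
  induction k generalizing n with
  | zero => simp
  | succ k ih =>
    obtain ⟨n, rfl⟩ : ∃ m, n = m + 1 := ⟨n - 1, by omega⟩
    have hkn : k ≤ n := by omega
    have h := Nat.add_one_mul_choose_eq n k
    have h' : ((n : ℝ) + 1) * n.choose k = (n + 1).choose (k + 1) * (k + 1) := by exact_mod_cast h
    have h1 : ((n + 1).choose (k + 1) : ℝ) = (n + 1) / (k + 1) * n.choose k := by
      field_simp; linarith
    rw [h1, pow_succ', Nat.cast_succ, Nat.cast_succ]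
    refine mul_le_mul_of_nonneg_left ?_ (by positivity)
    rcases Nat.eq_zero_or_pos k with rfl | hk0
    · simp
    refine le_trans ?_ (ih hkn)
    have hk0' : (0 : ℝ) < k := by exact_mod_cast hk0
    have : (k : ℝ) ≤ n := by exact_mod_cast hkn
    gcongr ?_ ^ k
    rw [div_le_div_iff₀ (by positivity) hk0']
    nlinarith

theorem two_mul_choose_two (k : ℕ) : 2 * k.choose 2 = k * (k - 1) := by
  rw [Nat.choose_two_right, Nat.mul_div_cancel' k.even_mul_pred_self.two_dvd]

theorem half_pow_choose_two_sq (k : ℕ) :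
    ((2 : ℝ)⁻¹ ^ k.choose 2) ^ 2 = ((2 : ℝ)⁻¹ ^ (k - 1)) ^ k := by
  rw [← pow_mul, ← pow_mul, mul_comm, two_mul_choose_two, mul_comm]

/-- `n ^ 2` and `m ^ 2 * 2 ^ m` agree up to the factor `D`. -/
structure Balanced (D : ℝ) (n m : ℕ) : Prop where
  le_left : (m : ℝ) ^ 2 * 2 ^ m ≤ D * n ^ 2
  le_right : (n : ℝ) ^ 2 ≤ D * m ^ 2 * 2 ^ m

theorem Balanced.mono {D D' : ℝ} {n m : ℕ} (h : Balanced D n m) (hD : D ≤ D') :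
    Balanced D' n m :=
  ⟨h.1.trans (by gcongr), h.2.trans (by gcongr)⟩

theorem Balanced.succ {D : ℝ} {n m : ℕ} (h : Balanced D n m) (hD : 0 ≤ D) (hm : 1 ≤ m) :
    Balanced (8 * D) n (m + 1) := by
  have hm' : (1 : ℝ) ≤ m := by exact_mod_cast hm
  have h2 : (0 : ℝ) < 2 ^ m := by positivity
  constructor
  · have : ((m + 1 : ℕ) : ℝ) ^ 2 ≤ 4 * m ^ 2 := by push_cast; nlinarith
    calc ((m + 1 : ℕ) : ℝ) ^ 2 * 2 ^ (m + 1) ≤ 4 * (m : ℝ) ^ 2 * 2 ^ (m + 1) := by gcongr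
      _ = 8 * ((m : ℝ) ^ 2 * 2 ^ m) := by ring
      _ ≤ 8 * (D * n ^ 2) := by linarith [h.1]
      _ = _ := by ring
  · refine h.2.trans ?_
    have : (m : ℝ) ^ 2 ≤ ((m + 1 : ℕ) : ℝ) ^ 2 := by push_cast; nlinarith
    gcongr
    · linarith
    · norm_num
    · omega

theorem Balanced.pred {D : ℝ} {n m : ℕ} (h : Balanced D n (m + 1)) (hD : 0 ≤ D) (hm : 1 ≤ m) :
    Balanced (8 * D) n m := by
  have hm' : (1 : ℝ) ≤ m := by exact_mod_cast hm
  have h2 : (0 : ℝ) < 2 ^ m := by positivity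
  constructor
  · have h3 : (m : ℝ) ^ 2 ≤ ((m + 1 : ℕ) : ℝ) ^ 2 := by push_cast; nlinarith
    have h4 : (2 : ℝ) ^ m ≤ 2 ^ (m + 1) := by gcongr <;> norm_num
    calc (m : ℝ) ^ 2 * 2 ^ m ≤ ((m + 1 : ℕ) : ℝ) ^ 2 * 2 ^ (m + 1) := by gcongr
      _ ≤ D * n ^ 2 := h.1
      _ ≤ _ := by gcongr; linarith
  · have : ((m + 1 : ℕ) : ℝ) ^ 2 ≤ 4 * m ^ 2 := by push_cast; nlinarith
    calc (n : ℝ) ^ 2 ≤ D * ((m + 1 : ℕ) : ℝ) ^ 2 * 2 ^ (m + 1) := h.2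
      _ ≤ D * (4 * m ^ 2) * 2 ^ (m + 1) := by gcongr
      _ = _ := by ring

theorem sq_le_of_f_le {C : ℝ} (hC : 1 ≤ C) {n k : ℕ} (hk : 1 ≤ k) (hkn : k ≤ n)
    (hf : f n k ≤ C) : (n : ℝ) ^ 2 ≤ C ^ 2 * k ^ 2 * 2 ^ k := by
  have hk0 : (0 : ℝ) < k := by exact_mod_cast hk
  have h1 : (n / k : ℝ) ^ k * (2 : ℝ)⁻¹ ^ (k.choose 2) ≤ C ^ k := by
    refine le_trans ?_ (hf.trans (le_self_pow₀ hC (by omega)))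
    rw [f_eq]
    gcongr
    exact div_pow_le_choose hkn
  have h2 : ((n / k : ℝ) ^ 2 * (2 : ℝ)⁻¹ ^ (k - 1)) ^ k ≤ (C ^ 2) ^ k := by
    have := pow_le_pow_left₀ (by positivity) h1 2
    rw [mul_pow, half_pow_choose_two_sq] at this
    rw [mul_pow, ← pow_mul, ← pow_mul C, mul_comm 2 k, pow_mul, pow_mul]
    exact this
  have h3 := le_of_pow_le_pow_left₀ (by omega) (by positivity) h2
  have h4 : (2 : ℝ) ^ (k - 1) ≤ 2 ^ k := by gcongr <;> [norm_num; omega]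
  rw [inv_pow, ← div_eq_mul_inv, div_le_iff₀ (by positivity), div_pow, div_le_iff₀ (by positivity)]
    at h3
  calc (n : ℝ) ^ 2 ≤ C ^ 2 * 2 ^ (k - 1) * k ^ 2 := h3
    _ ≤ C ^ 2 * 2 ^ k * k ^ 2 := by gcongr
    _ = _ := by ring

theorem le_sq_of_le_f {C : ℝ} (hC : 1 ≤ C) {n k : ℕ} (hk : 1 ≤ k)
    (hf : 1 ≤ C * f n k) : (k : ℝ) ^ 2 * 2 ^ k ≤ 2 * (C * exp 1) ^ 2 * n ^ 2 := by
  have hk0 : (0 : ℝ) < k := by exact_mod_cast hk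
  have hfac : (k : ℝ) ^ k / k.factorial ≤ exp 1 ^ k := by
    rw [← Real.exp_nat_mul, mul_one]
    exact Real.pow_div_factorial_le_exp _ hk0.le k
  have hch : (n.choose k : ℝ) * k ^ k ≤ n ^ k * exp 1 ^ k := by
    have h0 : (n.choose k : ℝ) ≤ n ^ k / k.factorial := Nat.choose_le_pow_div k n
    have hk! : (0 : ℝ) < k.factorial := by exact_mod_cast Nat.factorial_pos k
    calc (n.choose k : ℝ) * k ^ k ≤ n ^ k / k.factorial * k ^ k := by gcongr
      _ = n ^ k * (k ^ k / k.factorial) := by ring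
      _ ≤ _ := by gcongr
  have h1 : (k : ℝ) ^ k ≤ (C * exp 1 * n) ^ k * (2 : ℝ)⁻¹ ^ (k.choose 2) := by
    have h5 : 1 ≤ C ^ k * f n k :=
      hf.trans (mul_le_mul_of_nonneg_right (le_self_pow₀ hC (by omega)) (f_nonneg n k))
    rw [f_eq] at h5
    calc (k : ℝ) ^ k ≤ k ^ k * (C ^ k * (n.choose k * (2 : ℝ)⁻¹ ^ (k.choose 2))) :=
          le_mul_of_one_le_right (by positivity) h5
      _ = C ^ k * (n.choose k * k ^ k) * (2 : ℝ)⁻¹ ^ (k.choose 2) := by ring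
      _ ≤ C ^ k * (n ^ k * exp 1 ^ k) * (2 : ℝ)⁻¹ ^ (k.choose 2) := by gcongr
      _ = _ := by rw [mul_pow, mul_pow]; ring
  have h2 : ((k : ℝ) ^ 2) ^ k ≤ ((C * exp 1 * n) ^ 2 * (2 : ℝ)⁻¹ ^ (k - 1)) ^ k := by
    have := pow_le_pow_left₀ (by positivity) h1 2
    rw [mul_pow, half_pow_choose_two_sq] at this
    rw [mul_pow, ← pow_mul, ← pow_mul _ 2 k, mul_comm 2 k, pow_mul, pow_mul]
    exact this
  have h3 := le_of_pow_le_pow_left₀ (by omega) (by positivity) h2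
  obtain ⟨l, rfl⟩ : ∃ l, k = l + 1 := ⟨k - 1, by omega⟩
  rw [inv_pow, ← div_eq_mul_inv, le_div_iff₀ (by positivity), Nat.add_sub_cancel] at h3
  calc ((l + 1 : ℕ) : ℝ) ^ 2 * 2 ^ (l + 1) = 2 * (((l + 1 : ℕ) : ℝ) ^ 2 * 2 ^ l) := by ring
    _ ≤ 2 * (C * exp 1 * n) ^ 2 := by linarith
    _ = _ := by ring

theorem le_of_f_pos {n k : ℕ} (h : 0 < f n k) : k ≤ n := by
  by_contra hk
  rw [f_eq, Nat.choose_eq_zero_of_lt (by omega)] at h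
  simp at h

theorem exists_balanced {c1 c2 : ℝ} (hc1 : 0 < c1) :
    ∃ D, 1 ≤ D ∧ ∀ n k, 1 ≤ k → c1 ≤ f n k → f n k ≤ c2 → Balanced D n k := by
  set C := max 1 (max c2 c1⁻¹) with hC
  have hC1 : 1 ≤ C := le_max_left _ _
  have hCe : 1 ≤ exp 1 := Real.one_le_exp zero_le_one
  have h1 : C ^ 2 ≤ 2 * (C * exp 1) ^ 2 := by
    have : C ^ 2 ≤ (C * exp 1) ^ 2 := by
      gcongr; exact le_mul_of_one_le_right (by linarith) hCe
    nlinarith [sq_nonneg (C * exp 1)]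
  refine ⟨2 * (C * exp 1) ^ 2, (one_le_pow₀ hC1).trans h1, fun n k hk hl hu => ⟨?_, ?_⟩⟩
  · refine le_sq_of_le_f hC1 hk ?_
    calc 1 = c1⁻¹ * c1 := (inv_mul_cancel₀ hc1.ne').symm
      _ ≤ C * f n k := by
        gcongr
        exact (le_max_right _ _).trans (le_max_right _ _)
  · refine (sq_le_of_f_le hC1 hk (le_of_f_pos (hc1.trans_le hl))
      (hu.trans ((le_max_left _ _).trans (le_max_right _ _)))).trans ?_
    gcongr

/-- The fourth root of two. -/
noncomputable def root : ℝ := √(√2)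

theorem root_pow_four : root ^ 4 = 2 := by
  rw [root, show (4 : ℕ) = 2 * 2 from rfl, pow_mul, Real.sq_sqrt (by positivity),
    Real.sq_sqrt (by positivity)]

theorem root_pos : 0 < root := by unfold root; positivity

theorem one_lt_root : 1 < root := by
  by_contra! h
  have := pow_le_one₀ root_pos.le h (n := 4)
  rw [root_pow_four] at this
  norm_num at this

theorem two_pow_eq_root_pow (m : ℕ) : (2 : ℝ) ^ m = root ^ (4 * m) := by
  rw [pow_mul, root_pow_four]

/-- A rate tending to zero that dominates the error terms at set size `m`. -/
noncomputable def decayRate (D : ℝ) (m : ℕ) : ℝ := 2 * D * m ^ 4 / root ^ m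

theorem tendsto_mul_decayRate (D : ℝ) :
    Tendsto (fun m : ℕ => m * decayRate D m) atTop (nhds 0) := by
  have := (tendsto_pow_const_div_const_pow_of_one_lt 5 one_lt_root).const_mul (2 * D)
  rw [mul_zero] at this
  refine this.congr fun m => ?_
  rw [decayRate]; ring

theorem decayRate_nonneg {D : ℝ} (hD : 0 ≤ D) (m : ℕ) : 0 ≤ decayRate D m := by
  have := root_pos
  unfold decayRate; positivity

theorem Balanced.div_two_pow_le {D : ℝ} {n m : ℕ} (h : Balanced D n m) (hD : 1 ≤ D)
    (hm : 1 ≤ m) : (n : ℝ) / 2 ^ m ≤ decayRate D m := by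
  have hr := root_pos
  have hm' : (1 : ℝ) ≤ m := by exact_mod_cast hm
  refine le_of_sq_le_sq ?_ (decayRate_nonneg (by linarith) m)
  calc ((n : ℝ) / 2 ^ m) ^ 2 = n ^ 2 / (2 ^ m) ^ 2 := div_pow _ _ _
    _ ≤ D * m ^ 2 * 2 ^ m / (2 ^ m) ^ 2 := by gcongr; exact h.2
    _ = D * m ^ 2 / root ^ (4 * m) := by rw [← two_pow_eq_root_pow]; field_simp
    _ ≤ (2 * D) ^ 2 * (m ^ 4) ^ 2 / root ^ (2 * m) := by
      have h1 : D ≤ (2 * D) ^ 2 := by nlinarith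
      have h2 : (m : ℝ) ^ 2 ≤ (m ^ 4) ^ 2 := by
        rw [← pow_mul]; exact pow_le_pow_right₀ hm' (by norm_num)
      have h3 := one_lt_root.le
      gcongr
      norm_num
    _ = decayRate D m ^ 2 := by
      rw [decayRate, div_pow, ← pow_mul root, mul_pow (2 * D), mul_comm m 2]

theorem Balanced.pow_four_le {D : ℝ} {n m : ℕ} (h : Balanced D n m) (hD : 1 ≤ D)
    (hm : 1 ≤ m) : (m : ℝ) ^ 4 ≤ decayRate D m * n ^ 2 := by
  have hr := root_pos
  have hm' : (1 : ℝ) ≤ m := by exact_mod_cast hm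
  have h1 : (m : ℝ) ^ 2 ≤ 2 * m ^ 4 := by
    have := pow_le_pow_right₀ hm' (show 2 ≤ 4 by norm_num)
    have : (0 : ℝ) ≤ m ^ 4 := by positivity
    linarith
  calc (m : ℝ) ^ 4 = m ^ 2 * (m ^ 2 * 2 ^ m) / 2 ^ m := by field_simp
    _ ≤ m ^ 2 * (D * n ^ 2) / 2 ^ m := by gcongr ?_ * ?_ / _; exact h.1
    _ ≤ 2 * m ^ 4 * (D * n ^ 2) / 2 ^ m := by gcongr
    _ ≤ 2 * m ^ 4 * (D * n ^ 2) / root ^ m := by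
      rw [two_pow_eq_root_pow]
      have h3 := one_lt_root.le
      gcongr
      omega
    _ = _ := by rw [decayRate]; ring

theorem weightedF_succ (a : ℝ) {n m : ℕ} (hm : m ≤ n) :
    weightedF a n (m + 1) * ((m + 1) * 2 ^ m) = weightedF a n m * (a * (n - m)) := by
  have h := Nat.choose_succ_right_eq n m
  have h' : (n.choose (m + 1) : ℝ) * (m + 1) = n.choose m * (n - m) := by
    rw [← Nat.cast_sub hm]; exact_mod_cast h
  have h2 : (m + 1).choose 2 = m.choose 2 + m := by
    rw [Nat.choose_succ_succ' m 1, Nat.choose_one_right, add_comm]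
  rw [weightedF, weightedF, f_eq, f_eq, h2, pow_add _ (m.choose 2)]
  calc a ^ (m + 1) * (n.choose (m + 1) * ((2 : ℝ)⁻¹ ^ m.choose 2 * (2 : ℝ)⁻¹ ^ m)) *
        ((m + 1) * 2 ^ m)
      = a ^ (m + 1) * ((n.choose (m + 1) * (m + 1)) * (2 : ℝ)⁻¹ ^ m.choose 2) *
        ((2 : ℝ)⁻¹ ^ m * 2 ^ m) := by ring
    _ = _ := by rw [h', ← mul_pow, inv_mul_cancel₀ two_ne_zero, one_pow]; ring

theorem overlap_term_le_of_le {a D : ℝ} {n m l : ℕ} (ha : 1 ≤ a) (hD : 1 ≤ D)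
    (h : Balanced D n m) (hmn : m ≤ n) (hη : decayRate D m ≤ 1) (hl : 2 ≤ l)
    (hlm : 4 * l ≤ 3 * m) :
    (m.choose l : ℝ) ^ 2 / weightedF a n l ≤ decayRate D m := by
  have hr := root_pos
  have hm' : (1 : ℝ) ≤ m := by exact_mod_cast (show 1 ≤ m by omega)
  have hn' : (1 : ℝ) ≤ n := by exact_mod_cast (show 1 ≤ n by omega)
  have hl' : (2 : ℝ) ≤ l := by exact_mod_cast hl
  have hlm' : (l : ℝ) ≤ m := by exact_mod_cast (show l ≤ m by omega)
  have hln : l ≤ n := by omega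
  set p : ℝ := (2 : ℝ)⁻¹ ^ l.choose 2 with hp
  have hp0 : 0 < p := by positivity
  have h1 : (m.choose l : ℝ) ^ 2 / weightedF a n l ≤ (m ^ 2) ^ l / ((n / l) ^ l * p) := by
    have e1 : (m.choose l : ℝ) ^ 2 ≤ (m ^ 2) ^ l := by
      rw [← pow_mul, mul_comm, pow_mul]
      gcongr
      exact_mod_cast Nat.choose_le_pow m l
    have e2 : (n / l : ℝ) ^ l * p ≤ weightedF a n l := by
      rw [weightedF, f_eq]
      refine le_trans ?_ (le_mul_of_one_le_left (by positivity) (one_le_pow₀ ha))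
      gcongr
      exact div_pow_le_choose hln
    gcongr
  refine h1.trans (le_of_sq_le_sq ?_ (decayRate_nonneg (by linarith) m))
  have h2 : ((m ^ 2 : ℝ) ^ l / ((n / l) ^ l * p)) ^ 2 =
      (m ^ 4 * l ^ 2 * 2 ^ (l - 1) / n ^ 2) ^ l := by
    have e : p ^ 2 = ((2 : ℝ)⁻¹ ^ (l - 1)) ^ l := half_pow_choose_two_sq l
    rw [div_pow, mul_pow, e, ← pow_mul _ l 2, ← pow_mul _ l 2, mul_comm l 2, pow_mul, pow_mul,
      ← mul_pow, ← div_pow]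
    congr 1
    rw [inv_pow]
    field_simp
  rw [h2]
  have h3 : (m : ℝ) ^ 4 * l ^ 2 * 2 ^ (l - 1) / n ^ 2 ≤ decayRate D m := by
    rw [div_le_iff₀ (by positivity)]
    have e3 : (2 : ℝ) ^ (l - 1) * root ^ m ≤ 2 ^ m := by
      rw [two_pow_eq_root_pow, two_pow_eq_root_pow, ← pow_add]
      exact pow_le_pow_right₀ one_lt_root.le (by omega)
    have e4 : (2 : ℝ) ^ (l - 1) ≤ 2 ^ m / root ^ m := by
      rw [le_div_iff₀ (by positivity)]; exact e3
    have e5 : (0 : ℝ) ≤ m ^ 4 / root ^ m * (D * n ^ 2) := by positivity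
    calc (m : ℝ) ^ 4 * l ^ 2 * 2 ^ (l - 1) ≤ m ^ 4 * m ^ 2 * (2 ^ m / root ^ m) := by gcongr
      _ = m ^ 4 / root ^ m * (m ^ 2 * 2 ^ m) := by ring
      _ ≤ m ^ 4 / root ^ m * (D * n ^ 2) := by gcongr ?_ * ?_; exact h.1
      _ ≤ 2 * (m ^ 4 / root ^ m * (D * n ^ 2)) := by linarith
      _ = _ := by rw [decayRate]; ring
  calc _ ≤ decayRate D m ^ l := by gcongr
    _ ≤ decayRate D m ^ 2 := pow_le_pow_of_le_one (decayRate_nonneg (by linarith) m) hη hl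

theorem overlap_term_le_succ {a D : ℝ} {n m l : ℕ} (ha : 1 ≤ a) (ha2 : a ≤ 2) (hD : 1 ≤ D)
    (h : Balanced D n m) (hmn : m ≤ n) (hlm : 3 * m < 4 * l) (hl : l < m) :
    (m.choose l : ℝ) ^ 2 / weightedF a n l ≤
      decayRate D m * ((m.choose (l + 1) : ℝ) ^ 2 / weightedF a n (l + 1)) := by
  have hr := root_pos
  have hm' : (1 : ℝ) ≤ m := by exact_mod_cast (show 1 ≤ m by omega)
  have hlm1 : (l : ℝ) + 1 ≤ m := by exact_mod_cast (show l + 1 ≤ m by omega)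
  have hln1 : (m : ℝ) ≤ n := by exact_mod_cast hmn
  have hw := weightedF_pos (a := a) (n := n) (m := l) (by linarith) (by omega)
  have hw1 := weightedF_pos (a := a) (n := n) (m := l + 1) (by linarith) (by omega)
  have hrec := weightedF_succ a (n := n) (m := l) (by omega)
  have hch : (m.choose (l + 1) : ℝ) * (l + 1) = m.choose l * (m - l) := by
    rw [← Nat.cast_sub hl.le]; exact_mod_cast Nat.choose_succ_right_eq m l
  have hle : (m.choose l : ℝ) ≤ m.choose (l + 1) * (l + 1) := by
    rw [hch]; exact le_mul_of_one_le_right (by positivity) (by linarith)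
  have hrate : 2 * m * n / 2 ^ l ≤ decayRate D m := by
    refine le_of_sq_le_sq ?_ (decayRate_nonneg (by linarith) m)
    have e1 : root ^ (2 * m) * 2 ^ m ≤ (2 ^ l) ^ 2 := by
      rw [two_pow_eq_root_pow, two_pow_eq_root_pow, ← pow_add, ← pow_mul]
      exact pow_le_pow_right₀ one_lt_root.le (by omega)
    have e2 : (2 : ℝ) ^ m / (2 ^ l) ^ 2 ≤ 1 / root ^ (2 * m) := by
      rw [div_le_div_iff₀ (by positivity) (by positivity)]; linarith
    calc (2 * m * n / 2 ^ l : ℝ) ^ 2 = 4 * m ^ 2 * n ^ 2 / (2 ^ l) ^ 2 := by ring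
      _ ≤ 4 * m ^ 2 * (D * m ^ 2 * 2 ^ m) / (2 ^ l) ^ 2 := by gcongr; exact h.2
      _ = 4 * D * m ^ 4 * (2 ^ m / (2 ^ l) ^ 2) := by ring
      _ ≤ 4 * D * m ^ 4 * (1 / root ^ (2 * m)) := by gcongr
      _ ≤ 4 * D ^ 2 * (m ^ 4) ^ 2 * (1 / root ^ (2 * m)) := by
        have h2 : (m : ℝ) ^ 4 ≤ (m ^ 4) ^ 2 := by
          rw [← pow_mul]; exact pow_le_pow_right₀ hm' (by norm_num)
        have h3 : D ≤ D ^ 2 := by nlinarith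
        gcongr
      _ = decayRate D m ^ 2 := by rw [decayRate, mul_comm 2 m, pow_mul]; ring
  have hkey : (m.choose l : ℝ) ^ 2 / weightedF a n l ≤
      (2 * m * n / 2 ^ l) * ((m.choose (l + 1) : ℝ) ^ 2 / weightedF a n (l + 1)) := by
    have e : weightedF a n (l + 1) ≤ weightedF a n l * (2 * n) / ((l + 1) * 2 ^ l) := by
      rw [le_div_iff₀ (by positivity), hrec]
      have : (0 : ℝ) ≤ l := by positivity
      have : a * (n - l) ≤ 2 * n := by nlinarith
      gcongr
    rw [div_le_iff₀ hw]
    calc (m.choose l : ℝ) ^ 2 ≤ (m.choose (l + 1) * (l + 1)) ^ 2 := by gcongr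
      _ = (m.choose (l + 1) : ℝ) ^ 2 * (l + 1) * (l + 1) := by ring
      _ ≤ (m.choose (l + 1) : ℝ) ^ 2 * (l + 1) * m := by gcongr
      _ = (m.choose (l + 1) : ℝ) ^ 2 * (l + 1) * m *
          (weightedF a n (l + 1) / weightedF a n (l + 1)) := by rw [div_self hw1.ne', mul_one]
      _ ≤ (m.choose (l + 1) : ℝ) ^ 2 * (l + 1) * m *
          (weightedF a n l * (2 * n) / ((l + 1) * 2 ^ l) / weightedF a n (l + 1)) := by gcongr
      _ = _ := by field_simp
  exact hkey.trans (mul_le_mul_of_nonneg_right hrate (by positivity))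

theorem overlapSum_nonneg {a : ℝ} (ha : 0 ≤ a) (n m : ℕ) : 0 ≤ overlapSum a n m :=
  Finset.sum_nonneg fun l _ => div_nonneg (sq_nonneg _) (weightedF_nonneg ha n l)

theorem overlapSum_le {a D : ℝ} {n m : ℕ} (ha : 1 ≤ a) (ha2 : a ≤ 2) (hD : 1 ≤ D)
    (h : Balanced D n m) (hmn : m ≤ n) (hη : decayRate D m ≤ 1) :
    overlapSum a n m ≤ m * decayRate D m * (1 + 1 / weightedF a n m) := by
  have hη0 := decayRate_nonneg (D := D) (by linarith) m
  have hφ := weightedF_pos (a := a) (n := n) (m := m) (by linarith) hmn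
  have hbig : ∀ d l, l + d = m → 3 * m < 4 * l →
      (m.choose l : ℝ) ^ 2 / weightedF a n l ≤ 1 / weightedF a n m := by
    intro d
    induction d with
    | zero => rintro l rfl _; simp
    | succ d ih =>
      intro l hl hl2
      have h1 := overlap_term_le_succ ha ha2 hD h hmn hl2 (by omega)
      have h2 := ih (l + 1) (by omega) (by omega)
      have h3 : 0 ≤ (m.choose (l + 1) : ℝ) ^ 2 / weightedF a n (l + 1) :=
        div_nonneg (sq_nonneg _) (weightedF_nonneg (by linarith) _ _)
      nlinarith
  have hterm : ∀ l ∈ Finset.Ico 2 m, (m.choose l : ℝ) ^ 2 / weightedF a n l ≤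
      decayRate D m * (1 + 1 / weightedF a n m) := by
    intro l hl
    rw [Finset.mem_Ico] at hl
    have hpos : 0 ≤ 1 / weightedF a n m := by positivity
    rcases le_or_gt (4 * l) (3 * m) with hc | hc
    · refine (overlap_term_le_of_le ha hD h hmn hη hl.1 hc).trans ?_
      nlinarith [mul_nonneg hη0 hpos]
    · refine (overlap_term_le_succ ha ha2 hD h hmn hc hl.2).trans ?_
      gcongr
      have := hbig (m - (l + 1)) (l + 1) (by omega) (by omega)
      linarith
  refine (Finset.sum_le_card_nsmul _ _ _ hterm).trans ?_
  rw [nsmul_eq_mul, Nat.card_Ico, mul_assoc]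
  gcongr
  exact_mod_cast Nat.sub_le m 2

section

variable {n : ℕ}

theorem sum_filter_pairs_le {ι : Type*} [DecidableEq ι] {X Y V : Finset ι} (hXY : Disjoint X Y)
    (hV : V ⊆ X ∪ Y) (R : ι → ι → Prop) [DecidableRel R] (hR : ∀ i j, R i j ↔ R j i)
    (h : ι → ι → ℝ) (h0 : ∀ i j, 0 ≤ h i j) (hs : ∀ i j, h i j = h j i) :
    ∑ i ∈ V, ∑ j ∈ V with R i j, h i j ≤
      ∑ i ∈ X, ∑ j ∈ X with R i j, h i j + 2 * ∑ i ∈ X, ∑ j ∈ Y with R i j, h i j +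
        ∑ i ∈ Y, ∑ j ∈ Y with R i j, h i j := by
  have h1 : ∑ i ∈ V, ∑ j ∈ V with R i j, h i j ≤
      ∑ i ∈ X ∪ Y, ∑ j ∈ X ∪ Y with R i j, h i j :=
    (Finset.sum_le_sum fun i _ => Finset.sum_le_sum_of_subset_of_nonneg
      (Finset.filter_subset_filter _ hV) fun j _ _ => h0 i j).trans
      (Finset.sum_le_sum_of_subset_of_nonneg hV fun i _ _ => Finset.sum_nonneg fun j _ => h0 i j)
  refine h1.trans (le_of_eq ?_)
  have h2 : ∑ i ∈ Y, ∑ j ∈ X with R i j, h i j = ∑ i ∈ X, ∑ j ∈ Y with R i j, h i j := by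
    simp only [Finset.sum_filter]
    rw [Finset.sum_comm]
    refine Finset.sum_congr rfl fun i _ => Finset.sum_congr rfl fun j _ => ?_
    rw [hs j i]
    exact if_congr (hR j i) rfl rfl
  have h3 : ∀ i, ∑ j ∈ X ∪ Y with R i j, h i j =
      ∑ j ∈ X with R i j, h i j + ∑ j ∈ Y with R i j, h i j := fun i => by
    rw [Finset.filter_union, Finset.sum_union (Finset.disjoint_filter_filter hXY)]
  simp only [h3]
  rw [Finset.sum_union hXY, Finset.sum_add_distrib, Finset.sum_add_distrib, h2]
  ring

/-- Bound for the deviation of the avoidance probabilities from products. -/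
noncomputable def poissonError (n k m : ℕ) : ℝ :=
  2 * weightedF 1 n k ^ 2 * overlapSum 1 n k +
    (4 * weightedF 1 n k * weightedF 2 n m + 2 * weightedF 2 n m ^ 2) * overlapSum 2 n m +
    (m.choose 2 : ℝ) ^ 2 / n.choose 2 * (weightedF 1 n k + weightedF 2 n m) ^ 2

theorem sum_sum_prob_inter_overlap_le {a b : ℝ}
    {col col' : Finset (Fin n) → Finset (Finset (Fin n))}
    (ha : 0 < a) (hcol : IsPartRule a col) (hcol' : IsPartRule b col') {k m : ℕ}
    (hm : m ≤ n) (hi : ∀ i ∈ parts col' k, i.1.card < m ∨ i ∈ parts col m) :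
    ∑ i ∈ parts col' k, ∑ j ∈ parts col m with j ≠ i ∧ Overlap i j,
      (erdosRenyi n (1 / 2)).real (partEvent i ∩ partEvent j) ≤
      2 * weightedF a n m * overlapSum a n m * weightedF b n k := by
  refine (Finset.sum_le_sum fun i h => sum_prob_inter_overlap_le ha hcol hm (hi i h)).trans ?_
  rw [← Finset.mul_sum]
  have := weightedF_nonneg ha.le n m
  have := overlapSum_nonneg ha.le n m
  gcongr
  exact sum_prob_parts_le hcol' k

theorem sum_sum_prob_mul_overlap_le {a b : ℝ} {col col' : Finset (Fin n) → Finset (Finset (Fin n))}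
    (ha : 0 < a) (hcol : IsPartRule a col) (hcol' : IsPartRule b col') {k m M : ℕ}
    (hm2 : 2 ≤ m) (hm : m ≤ n) (hkM : k ≤ M) (hmM : m ≤ M) :
    ∑ i ∈ parts col' k, ∑ j ∈ parts col m with j ≠ i ∧ Overlap i j,
      (erdosRenyi n (1 / 2)).real (partEvent i) * (erdosRenyi n (1 / 2)).real (partEvent j) ≤
      (M.choose 2 : ℝ) ^ 2 / n.choose 2 * weightedF a n m * weightedF b n k := by
  have h0 := weightedF_nonneg ha.le n m
  refine (Finset.sum_le_sum (g := fun i => (M.choose 2 : ℝ) ^ 2 / n.choose 2 * weightedF a n m *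
    (erdosRenyi n (1 / 2)).real (partEvent i)) fun i h => ?_).trans ?_
  · refine (sum_prob_mul_overlap_le ha hcol i hm2 hm).trans ?_
    rw [(mem_parts.1 h).1, sq]
    have h1 : (k.choose 2 : ℝ) ≤ M.choose 2 := by exact_mod_cast Nat.choose_le_choose 2 hkM
    have h2 : (m.choose 2 : ℝ) ≤ M.choose 2 := by exact_mod_cast Nat.choose_le_choose 2 hmM
    gcongr
  · rw [← Finset.mul_sum]
    gcongr
    exact sum_prob_parts_le hcol' k

theorem abs_prob_avoid_sub_prod_le {k m : ℕ} (hk : 2 ≤ k) (hkm : k < m) (hm : m ≤ n)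
    {V : Finset (Σ _ : Finset (Fin n), Finset (Fin n))}
    (hV : V ⊆ parts emptyPart k ∪ parts properParts m) :
    |(erdosRenyi n (1 / 2)).real (⋂ j ∈ V, (partEvent j)ᶜ) -
      ∏ i ∈ V, (1 - (erdosRenyi n (1 / 2)).real (partEvent i))| ≤ poissonError n k m := by
  obtain ⟨hlow, hup⟩ := prod_one_sub_le_prob_avoid_and_le (μ := erdosRenyi n (1 / 2)) partEvent
    Overlap prob_partEvent_inter_avoid V
  have hR : ∀ i j : Σ _ : Finset (Fin n), Finset (Fin n),
      (j ≠ i ∧ Overlap i j) ↔ (i ≠ j ∧ Overlap j i) := fun i j => by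
    rw [overlap_comm, ne_comm]
  have hX := isPartRule_emptyPart (n := n)
  have hY := isPartRule_properParts (n := n)
  have hw1 := weightedF_nonneg zero_le_one n k
  have hw2 := weightedF_nonneg zero_le_two n m
  have hq1 := overlapSum_nonneg zero_le_one n k
  have hq2 := overlapSum_nonneg zero_le_two n m
  have hb1 := sum_filter_pairs_le (disjoint_parts k m) hV (fun i j => j ≠ i ∧ Overlap i j) hR
    (fun i j => (erdosRenyi n (1 / 2)).real (partEvent i) *
      (erdosRenyi n (1 / 2)).real (partEvent j)) (fun i j => by positivity)
    (fun i j => mul_comm _ _)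
  have hb2 := sum_filter_pairs_le (disjoint_parts k m) hV (fun i j => j ≠ i ∧ Overlap i j) hR
    (fun i j => (erdosRenyi n (1 / 2)).real (partEvent i ∩ partEvent j))
    (fun i j => measureReal_nonneg) (fun i j => by rw [Set.inter_comm])
  have e1 := sum_sum_prob_inter_overlap_le one_pos hX hX (k := k) (m := k)
    (by omega) (fun i h => Or.inr h)
  have e2 := sum_sum_prob_inter_overlap_le two_pos hY hX (k := k) (m := m)
    hm (fun i h => Or.inl ((mem_parts.1 h).1.trans_lt hkm))
  have e3 := sum_sum_prob_inter_overlap_le two_pos hY hY (k := m) (m := m)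
    hm (fun i h => Or.inr h)
  have d1 := sum_sum_prob_mul_overlap_le one_pos hX hX (k := k) (m := k) (M := m)
    hk (by omega) hkm.le hkm.le
  have d2 := sum_sum_prob_mul_overlap_le two_pos hY hX (k := k) (m := m) (M := m)
    (by omega) hm hkm.le le_rfl
  have d3 := sum_sum_prob_mul_overlap_le two_pos hY hY (k := m) (m := m) (M := m)
    (by omega) hm le_rfl le_rfl
  have hκ : 0 ≤ (m.choose 2 : ℝ) ^ 2 / n.choose 2 := by positivity
  set κ := (m.choose 2 : ℝ) ^ 2 / n.choose 2
  have p1 : 0 ≤ 2 * weightedF 1 n k ^ 2 * overlapSum 1 n k +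
    (4 * weightedF 1 n k * weightedF 2 n m + 2 * weightedF 2 n m ^ 2) * overlapSum 2 n m := by
    positivity
  have p2 : 0 ≤ κ * (weightedF 1 n k + weightedF 2 n m) ^ 2 := by positivity
  rw [abs_le, poissonError]
  constructor
  · nlinarith
  · nlinarith

theorem exp_neg_two_mul_le {p : ℝ} (h0 : 0 ≤ p) (h : p ≤ 1 / 2) : exp (-(2 * p)) ≤ 1 - p := by
  have h1 : 2 * p + 1 ≤ exp (2 * p) := Real.add_one_le_exp _
  have h2 : exp (-(2 * p)) * exp (2 * p) = 1 := by rw [← Real.exp_add]; simp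
  have h3 := Real.exp_pos (-(2 * p))
  nlinarith

theorem prod_one_sub_bounds {col : Finset (Fin n) → Finset (Finset (Fin n))} {m : ℕ}
    (hm : 2 ≤ m) {u v : ℝ}
    (hu : u ≤ ∑ i ∈ parts col m, (erdosRenyi n (1 / 2)).real (partEvent i))
    (hv : ∑ i ∈ parts col m, (erdosRenyi n (1 / 2)).real (partEvent i) ≤ v) :
    exp (-(2 * v)) ≤ ∏ i ∈ parts col m, (1 - (erdosRenyi n (1 / 2)).real (partEvent i)) ∧
      ∏ i ∈ parts col m, (1 - (erdosRenyi n (1 / 2)).real (partEvent i)) ≤ exp (-u) := by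
  have hp : ∀ i ∈ parts col m, (erdosRenyi n (1 / 2)).real (partEvent i) ≤ 1 / 2 := by
    intro i hi
    rw [prob_partEvent, (mem_parts.1 hi).1, one_div]
    exact pow_le_of_le_one (by norm_num) (by norm_num) (Nat.choose_pos hm).ne'
  constructor
  · calc exp (-(2 * v)) ≤ exp (∑ i ∈ parts col m,
          -(2 * (erdosRenyi n (1 / 2)).real (partEvent i))) := by
          rw [Real.exp_le_exp, Finset.sum_neg_distrib, ← Finset.mul_sum]; linarith
      _ = ∏ i ∈ parts col m, exp (-(2 * (erdosRenyi n (1 / 2)).real (partEvent i))) :=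
          Real.exp_sum _ _
      _ ≤ _ := Finset.prod_le_prod (fun i _ => (Real.exp_pos _).le) fun i hi =>
          exp_neg_two_mul_le measureReal_nonneg (hp i hi)
  · calc _ ≤ ∏ i ∈ parts col m, exp (-(erdosRenyi n (1 / 2)).real (partEvent i)) :=
          Finset.prod_le_prod (fun i hi => by linarith [hp i hi]) fun i _ => by
            linarith [Real.add_one_le_exp (-(erdosRenyi n (1 / 2)).real (partEvent i))]
      _ = exp (∑ i ∈ parts col m, -(erdosRenyi n (1 / 2)).real (partEvent i)) :=
          (Real.exp_sum _ _).symm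
      _ ≤ _ := by rw [Real.exp_le_exp, Finset.sum_neg_distrib]; linarith

theorem sum_prob_parts_emptyPart (m : ℕ) :
    ∑ i ∈ parts emptyPart m, (erdosRenyi n (1 / 2)).real (partEvent i) = weightedF 1 n m := by
  rw [sum_prob_parts_eq, card_parts_emptyPart, weightedF, one_pow, one_mul, f_eq]

theorem weightedF_le_sum_prob_parts_properParts {m : ℕ} (hm : 2 ≤ m) :
    weightedF 2 n m / 4 ≤
      ∑ i ∈ parts properParts m, (erdosRenyi n (1 / 2)).real (partEvent i) := by
  have h : (2 : ℝ) ^ m * n.choose m ≤ 4 * (parts (properParts (n := n)) m).card := by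
    exact_mod_cast le_card_parts_properParts hm
  rw [sum_prob_parts_eq, weightedF, f_eq, ← mul_assoc, mul_div_right_comm]
  gcongr
  linarith

theorem prob_avoid_parts_le {a : ℝ} {col : Finset (Fin n) → Finset (Finset (Fin n))}
    (ha : 0 < a) (hcol : IsPartRule a col) {m : ℕ} (hm : m ≤ n)
    (hsum : weightedF a n m / 4 ≤
      ∑ i ∈ parts col m, (erdosRenyi n (1 / 2)).real (partEvent i)) :
    (erdosRenyi n (1 / 2)).real (⋂ j ∈ parts col m, (partEvent j)ᶜ) ≤
      16 / weightedF a n m + 32 * overlapSum a n m := by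
  have h1 := prob_avoid_mul_sq_le (μ := erdosRenyi n (1 / 2)) partEvent Overlap (parts col m)
    prob_partEvent_inter_of_not_overlap
  have h2 := sum_sum_prob_inter_overlap_le ha hcol hcol hm (fun i h => Or.inr h)
  have h3 := sum_prob_parts_le (n := n) hcol m
  have hw := weightedF_pos ha hm
  have hP : 0 ≤ (erdosRenyi n (1 / 2)).real (⋂ j ∈ parts col m, (partEvent j)ᶜ) :=
    measureReal_nonneg
  set P := (erdosRenyi n (1 / 2)).real (⋂ j ∈ parts col m, (partEvent j)ᶜ)
  set w := weightedF a n m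
  have h4 : P * (w / 4) ^ 2 ≤ w + 2 * w * overlapSum a n m * w := by
    refine le_trans ?_ (h1.trans (add_le_add h3 h2))
    gcongr
  have h5 : 16 / w + 32 * overlapSum a n m =
      (w + 2 * w * overlapSum a n m * w) / (w / 4) ^ 2 := by
    field_simp; ring
  rw [h5, le_div_iff₀ (by positivity)]
  exact h4

theorem one_sub_prob_avoid_parts_le {a : ℝ} {col : Finset (Fin n) → Finset (Finset (Fin n))}
    (hcol : IsPartRule a col) (m : ℕ) :
    (erdosRenyi n (1 / 2)).real (⋂ j ∈ parts col m, (partEvent j)ᶜ)ᶜ ≤ weightedF a n m := by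
  refine le_trans ?_ (sum_prob_parts_le hcol m)
  rw [Set.compl_iInter₂]
  simp only [compl_compl]
  exact measureReal_biUnion_finset_le _ _

end

section

variable {n : ℕ}

/-- A bound for the probability that `α` is not in `{k, k + 1}` or `β` not in `{k + 2, k + 3}`. -/
noncomputable def deviationBound (n k : ℕ) : ℝ :=
  weightedF 1 n (k + 2) + weightedF 2 n (k + 4) +
    (16 / weightedF 1 n k + 32 * overlapSum 1 n k) +
    (16 / weightedF 2 n (k + 2) + 32 * overlapSum 2 n (k + 2))

theorem avoid_emptyPart_eq (n k : ℕ) :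
    (⋂ i ∈ parts (emptyPart (n := n)) k, (partEvent i)ᶜ) = {ω | alpha (graphOf n ω) < k} :=
  Set.ext fun _ => mem_avoid_emptyPart_iff

theorem avoid_properParts_eq {k : ℕ} (n : ℕ) (hk : 2 ≤ k) :
    (⋂ i ∈ parts (properParts (n := n)) k, (partEvent i)ᶜ) = {ω | beta (graphOf n ω) < k} :=
  Set.ext fun _ => mem_avoid_properParts_iff hk

theorem prob_deviation_le {k : ℕ} (hk : k + 2 ≤ n) :
    (erdosRenyi n (1 / 2)).real
      ({ω | alpha (graphOf n ω) < k + 2}ᶜ ∪ {ω | beta (graphOf n ω) < k + 4}ᶜ ∪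
        {ω | alpha (graphOf n ω) < k} ∪ {ω | beta (graphOf n ω) < k + 2}) ≤
      deviationBound n k := by
  have h1 := one_sub_prob_avoid_parts_le (n := n) isPartRule_emptyPart (k + 2)
  have h2 := one_sub_prob_avoid_parts_le (n := n) isPartRule_properParts (k + 4)
  have hw := weightedF_nonneg zero_le_one n k
  have h3 := prob_avoid_parts_le (n := n) (m := k) one_pos isPartRule_emptyPart (by omega)
    (by rw [sum_prob_parts_emptyPart]; linarith)
  have h4 := prob_avoid_parts_le two_pos isPartRule_properParts hk
    (weightedF_le_sum_prob_parts_properParts (by omega))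
  rw [avoid_emptyPart_eq] at h1 h3
  rw [avoid_properParts_eq _ (by omega)] at h2 h4
  refine (measureReal_union_le _ _).trans (add_le_add ?_ h4)
  refine (measureReal_union_le _ _).trans (add_le_add ?_ h3)
  exact (measureReal_union_le _ _).trans (add_le_add h1 h2)

/-- A lower bound for the probability that a Poisson variable with mean in `[c, C]` vanishes
and for the probability that it does not. -/
noncomputable def poissonGap (c C : ℝ) : ℝ := min (exp (-(2 * C))) (1 - exp (-(c / 4)))

theorem poissonGap_pos {c : ℝ} (hc : 0 < c) (C : ℝ) : 0 < poissonGap c C :=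
  lt_min (Real.exp_pos _) (sub_pos.2 (by rw [Real.exp_lt_one_iff]; linarith))

theorem prob_quadrants_ge {c C : ℝ} {k m : ℕ} (hc : 0 < c) (hk : 2 ≤ k) (hkm : k < m) (hm : m ≤ n)
    (h1 : c ≤ weightedF 1 n k) (h1' : weightedF 1 n k ≤ C)
    (h2 : c ≤ weightedF 2 n m) (h2' : weightedF 2 n m ≤ C) {A B : Set (Sym2 (Fin n) → Bool)}
    (hA : A = {ω | alpha (graphOf n ω) < k} ∨ A = {ω | alpha (graphOf n ω) < k}ᶜ)
    (hB : B = {ω | beta (graphOf n ω) < m} ∨ B = {ω | beta (graphOf n ω) < m}ᶜ) :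
    poissonGap c C ^ 2 - 3 * poissonError n k m ≤ (erdosRenyi n (1 / 2)).real (A ∩ B) := by
  set μ := erdosRenyi n (1 / 2)
  have b1 := abs_prob_avoid_sub_prod_le hk hkm hm Finset.subset_union_left
  have b2 := abs_prob_avoid_sub_prod_le hk hkm hm Finset.subset_union_right
  have b3 := abs_prob_avoid_sub_prod_le hk hkm hm (Finset.Subset.refl _)
  have hun : (⋂ j ∈ parts emptyPart k ∪ parts properParts m, (partEvent (n := n) j)ᶜ) =
      {ω | alpha (graphOf n ω) < k} ∩ {ω | beta (graphOf n ω) < m} := by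
    rw [← avoid_emptyPart_eq, ← avoid_properParts_eq _ (by omega)]
    exact Finset.iInf_union
  rw [Finset.prod_union (disjoint_parts k m), hun] at b3
  rw [avoid_emptyPart_eq] at b1
  rw [avoid_properParts_eq _ (by omega)] at b2
  obtain ⟨p1, p2⟩ := prod_one_sub_bounds (n := n) (col := emptyPart) hk (u := c / 4) (v := C)
    (by rw [sum_prob_parts_emptyPart]; linarith) (by rw [sum_prob_parts_emptyPart]; linarith)
  obtain ⟨q1, q2⟩ := prod_one_sub_bounds (n := n) (col := properParts) (m := m) (by omega)
    (u := c / 4) (v := C)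
    ((by linarith : c / 4 ≤ weightedF 2 n m / 4).trans
      (weightedF_le_sum_prob_parts_properParts (by omega)))
    ((sum_prob_parts_le isPartRule_properParts m).trans h2')
  have g1 : poissonGap c C ≤ exp (-(2 * C)) := min_le_left _ _
  have g2 : poissonGap c C ≤ 1 - exp (-(c / 4)) := min_le_right _ _
  have g0 := poissonGap_pos hc C
  set δ := poissonGap c C
  set x := ∏ i ∈ parts emptyPart k, (1 - μ.real (partEvent i))
  set y := ∏ i ∈ parts properParts m, (1 - μ.real (partEvent i))
  set E := {ω | alpha (graphOf n ω) < k}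
  set F := {ω | beta (graphOf n ω) < m}
  have hE : μ.real (E ∩ F) + μ.real (E ∩ Fᶜ) = μ.real E := by
    rw [← Set.sdiff_eq]; exact measureReal_inter_add_sdiff .of_discrete
  have hF : μ.real (E ∩ F) + μ.real (Eᶜ ∩ F) = μ.real F := by
    rw [Set.inter_comm E, Set.inter_comm Eᶜ, ← Set.sdiff_eq]
    exact measureReal_inter_add_sdiff .of_discrete
  have hEc : μ.real (Eᶜ ∩ F) + μ.real (Eᶜ ∩ Fᶜ) = μ.real Eᶜ := by
    rw [← Set.sdiff_eq]; exact measureReal_inter_add_sdiff .of_discrete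
  have hE1 : μ.real Eᶜ = 1 - μ.real E := probReal_compl_eq_one_sub .of_discrete
  have x1 : δ ≤ x := g1.trans p1
  have x2 : δ ≤ 1 - x := by linarith
  have y1 : δ ≤ y := g1.trans q1
  have y2 : δ ≤ 1 - y := by linarith
  rw [abs_le] at b1 b2 b3
  have hmul : ∀ u v, δ ≤ u → δ ≤ v → δ ^ 2 ≤ u * v := fun u v hu hv => by
    rw [sq]; exact mul_le_mul hu hv g0.le (g0.le.trans hu)
  have r1 : δ ^ 2 ≤ x * y := hmul _ _ x1 y1
  have r2 : δ ^ 2 ≤ x * (1 - y) := hmul _ _ x1 y2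
  have r3 : δ ^ 2 ≤ (1 - x) * y := hmul _ _ x2 y1
  have r4 : δ ^ 2 ≤ (1 - x) * (1 - y) := hmul _ _ x2 y2
  rcases hA with rfl | rfl <;> rcases hB with rfl | rfl <;> linarith

theorem prob_case_ge {c C : ℝ} {k : ℕ} (hc : 0 < c) (hk : 1 ≤ k) (hkn : k + 3 ≤ n)
    (h1 : c ≤ weightedF 1 n (k + 1)) (h1' : weightedF 1 n (k + 1) ≤ C)
    (h2 : c ≤ weightedF 2 n (k + 3)) (h2' : weightedF 2 n (k + 3) ≤ C) {e1 e2 : ℕ}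
    (he1 : e1 ≤ 1) (he2 : e2 ≤ 1) :
    poissonGap c C ^ 2 - 3 * poissonError n (k + 1) (k + 3) - deviationBound n k ≤
      (erdosRenyi n (1 / 2)).real
        {ω | alpha (graphOf n ω) = k + 1 - e1 ∧ beta (graphOf n ω) = k + 3 - e2} := by
  have hd := prob_deviation_le (n := n) (k := k) (by omega)
  set A : Set (Sym2 (Fin n) → Bool) :=
    if e1 = 1 then {ω | alpha (graphOf n ω) < k + 1} else {ω | alpha (graphOf n ω) < k + 1}ᶜ with hA
  set B : Set (Sym2 (Fin n) → Bool) :=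
    if e2 = 1 then {ω | beta (graphOf n ω) < k + 3} else {ω | beta (graphOf n ω) < k + 3}ᶜ with hB
  have hq := prob_quadrants_ge (n := n) (k := k + 1) (m := k + 3) (A := A) (B := B) hc (by omega)
    (by omega) hkn h1 h1' h2 h2' (by rw [hA]; split_ifs <;> simp) (by rw [hB]; split_ifs <;> simp)
  set T : Set (Sym2 (Fin n) → Bool) :=
    {ω | alpha (graphOf n ω) = k + 1 - e1 ∧ beta (graphOf n ω) = k + 3 - e2}
  have hsub : A ∩ B ⊆ T ∪ ({ω | alpha (graphOf n ω) < k + 2}ᶜ ∪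
      {ω | beta (graphOf n ω) < k + 4}ᶜ ∪ {ω | alpha (graphOf n ω) < k} ∪
      {ω | beta (graphOf n ω) < k + 2}) := by
    rintro ω ⟨ha, hb⟩
    simp only [T, Set.mem_union, Set.mem_compl_iff, Set.mem_ofPred_eq]
    have ha' : e1 = 1 ∧ alpha (graphOf n ω) < k + 1 ∨ e1 = 0 ∧ ¬ alpha (graphOf n ω) < k + 1 := by
      rw [hA] at ha
      split_ifs at ha with h
      · exact Or.inl ⟨h, ha⟩
      · exact Or.inr ⟨by omega, ha⟩
    have hb' : e2 = 1 ∧ beta (graphOf n ω) < k + 3 ∨ e2 = 0 ∧ ¬ beta (graphOf n ω) < k + 3 := by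
      rw [hB] at hb
      split_ifs at hb with h
      · exact Or.inl ⟨h, hb⟩
      · exact Or.inr ⟨by omega, hb⟩
    omega
  have h3 := (measureReal_mono (μ := erdosRenyi n (1 / 2)) hsub).trans (measureReal_union_le _ _)
  linarith

theorem prob_four_cases_ge {k : ℕ} (hk : k + 2 ≤ n) :
    1 - deviationBound n k ≤ (erdosRenyi n (1 / 2)).real
      {ω | (alpha (graphOf n ω) = k + 1 ∧ beta (graphOf n ω) = k + 3) ∨
           (alpha (graphOf n ω) = k + 1 ∧ beta (graphOf n ω) = k + 2) ∨
           (alpha (graphOf n ω) = k ∧ beta (graphOf n ω) = k + 3) ∨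
           (alpha (graphOf n ω) = k ∧ beta (graphOf n ω) = k + 2)} := by
  have hd := prob_deviation_le hk
  set T := {ω | (alpha (graphOf n ω) = k + 1 ∧ beta (graphOf n ω) = k + 3) ∨
           (alpha (graphOf n ω) = k + 1 ∧ beta (graphOf n ω) = k + 2) ∨
           (alpha (graphOf n ω) = k ∧ beta (graphOf n ω) = k + 3) ∨
           (alpha (graphOf n ω) = k ∧ beta (graphOf n ω) = k + 2)}
  have hsub : Tᶜ ⊆ ({ω | alpha (graphOf n ω) < k + 2}ᶜ ∪
      {ω | beta (graphOf n ω) < k + 4}ᶜ ∪ {ω | alpha (graphOf n ω) < k} ∪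
      {ω | beta (graphOf n ω) < k + 2}) := by
    intro ω hω
    simp only [T, Set.mem_union, Set.mem_compl_iff, Set.mem_ofPred_eq] at hω ⊢
    omega
  have h3 := (measureReal_mono (μ := erdosRenyi n (1 / 2)) hsub).trans hd
  rw [probReal_compl_eq_one_sub .of_discrete] at h3
  linarith

end

section

variable {n : ℕ}

theorem weightedF_succ_le {a D : ℝ} {m : ℕ} (ha : 0 ≤ a) (ha2 : a ≤ 2) (hD : 1 ≤ D)
    (h : Balanced D n m) (hm1 : 1 ≤ m) (hm : m ≤ n) :
    weightedF a n (m + 1) ≤ weightedF a n m * (2 * decayRate D m) := by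
  have hw := weightedF_nonneg ha n m
  have hrec := weightedF_succ a hm
  have hm' : (m : ℝ) ≤ n := by exact_mod_cast hm
  have hm0 : (0 : ℝ) ≤ m := m.cast_nonneg
  have h1 : weightedF a n (m + 1) = weightedF a n m * (a * (n - m) / ((m + 1) * 2 ^ m)) := by
    rw [← mul_div_assoc, ← hrec, mul_div_cancel_right₀ _ (by positivity)]
  rw [h1]
  gcongr
  calc a * (n - m) / ((m + 1) * 2 ^ m) ≤ 2 * n / (1 * 2 ^ m) := by
        gcongr <;> linarith
    _ = 2 * (n / 2 ^ m) := by ring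
    _ ≤ _ := by gcongr; exact h.div_two_pow_le hD hm1

theorem weightedF_two_add_two_eq {k : ℕ} (hk : k + 1 ≤ n) :
    weightedF 2 n (k + 2) =
      2 * f n k * ((n - k) * (n - k - 1)) / ((k + 1) * (k + 2) * 2 ^ k) := by
  have h1 := weightedF_succ 2 (n := n) (m := k) (by omega)
  have h2 := weightedF_succ 2 (n := n) (m := k + 1) hk
  push_cast at h2
  have e0 : weightedF 2 n k = 2 ^ k * f n k := rfl
  have e1 : weightedF 2 n (k + 1) = 2 ^ k * f n k * (2 * (n - k)) / ((k + 1) * 2 ^ k) := by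
    rw [← e0, ← h1, mul_div_cancel_right₀ _ (by positivity)]
  have e2 : weightedF 2 n (k + 2) =
      weightedF 2 n (k + 1) * (2 * (n - (k + 1))) / ((k + 1 + 1) * 2 ^ (k + 1)) := by
    rw [← h2, mul_div_cancel_right₀ _ (by positivity)]
  rw [e2, e1]
  field_simp
  ring

theorem Balanced.weightedF_two_bounds {D c C : ℝ} {k : ℕ} (h : Balanced D n k) (hD : 1 ≤ D)
    (hc : 0 ≤ c) (hk1 : 1 ≤ k) (hk : 2 * (k + 1) ≤ n) (hl : c ≤ f n k) (hu : f n k ≤ C) :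
    c / (12 * D) ≤ weightedF 2 n (k + 2) ∧ weightedF 2 n (k + 2) ≤ 2 * C * D := by
  rw [weightedF_two_add_two_eq (by omega)]
  have hk1' : (1 : ℝ) ≤ k := by exact_mod_cast hk1
  have hk' : (2 : ℝ) * (k + 1) ≤ n := by exact_mod_cast hk
  have hC : 0 ≤ C := hc.trans (hl.trans hu)
  have hf0 := f_nonneg n k
  constructor
  · rw [le_div_iff₀ (by positivity), div_mul_eq_mul_div, div_le_iff₀ (by positivity)]
    have e1 : ((k : ℝ) + 1) * (k + 2) ≤ 6 * k ^ 2 := by nlinarith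
    have e2 : (n : ℝ) ^ 2 ≤ 4 * ((n - k) * (n - k - 1)) := by nlinarith
    calc c * ((k + 1) * (k + 2) * 2 ^ k) ≤ c * (6 * k ^ 2 * 2 ^ k) := by gcongr
      _ = 6 * c * (k ^ 2 * 2 ^ k) := by ring
      _ ≤ 6 * c * (D * n ^ 2) := mul_le_mul_of_nonneg_left h.1 (by positivity)
      _ ≤ 6 * f n k * (D * (4 * ((n - k) * (n - k - 1)))) := by gcongr
      _ = _ := by ring
  · rw [div_le_iff₀ (by positivity)]
    have e1 : (k : ℝ) ^ 2 ≤ (k + 1) * (k + 2) := by nlinarith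
    have e2 : ((n : ℝ) - k) * (n - k - 1) ≤ n ^ 2 := by nlinarith
    calc 2 * f n k * ((n - k) * (n - k - 1)) ≤ 2 * C * n ^ 2 := by
          have : (0 : ℝ) ≤ (n - k) * (n - k - 1) :=
            mul_nonneg (by linarith) (by linarith)
          gcongr
      _ ≤ 2 * C * (D * k ^ 2 * 2 ^ k) := mul_le_mul_of_nonneg_left h.2 (by positivity)
      _ ≤ 2 * C * (D * ((k + 1) * (k + 2)) * 2 ^ k) := by gcongr
      _ = _ := by ring

/-- The sum of the error rates at the set sizes `k, …, k + 3`. -/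
noncomputable def totalRate (D : ℝ) (k : ℕ) : ℝ :=
  ∑ i ∈ Finset.range 4, ((k + i : ℕ) : ℝ) * decayRate D (k + i)

theorem tendsto_totalRate (D : ℝ) : Tendsto (totalRate D) atTop (nhds 0) := by
  have := tendsto_finsetSum (Finset.range 4) fun i _ =>
    (tendsto_mul_decayRate D).comp (tendsto_add_atTop_nat i)
  simp only [Finset.sum_const_zero] at this
  exact this

theorem mul_decayRate_le_totalRate {D : ℝ} (hD : 0 ≤ D) (k : ℕ) {i : ℕ} (hi : i < 4) :
    ((k + i : ℕ) : ℝ) * decayRate D (k + i) ≤ totalRate D k :=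
  Finset.single_le_sum (f := fun i => ((k + i : ℕ) : ℝ) * decayRate D (k + i))
    (fun _ _ => mul_nonneg (Nat.cast_nonneg _) (decayRate_nonneg hD _)) (Finset.mem_range.2 hi)

theorem decayRate_le_totalRate {D : ℝ} (hD : 0 ≤ D) {k i : ℕ} (hk : 1 ≤ k) (hi : i < 4) :
    decayRate D (k + i) ≤ totalRate D k := by
  refine le_trans ?_ (mul_decayRate_le_totalRate hD k hi)
  exact le_mul_of_one_le_left (decayRate_nonneg hD _) (by exact_mod_cast (by omega : 1 ≤ k + i))

theorem Balanced.overlapSum_le_totalRate {a c D : ℝ} {k i : ℕ} (hi : i < 4) (ha : 1 ≤ a)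
    (ha2 : a ≤ 2) (hD : 1 ≤ D) (h : Balanced D n (k + i)) (hk : 1 ≤ k) (hkn : k + i ≤ n)
    (hr : totalRate D k ≤ 1) (hc : 0 < c) (hw : c ≤ weightedF a n (k + i)) :
    overlapSum a n (k + i) ≤ totalRate D k * (1 + 1 / c) := by
  have hD0 : 0 ≤ D := by linarith
  refine (overlapSum_le ha ha2 hD h hkn ((decayRate_le_totalRate hD0 hk hi).trans hr)).trans ?_
  have h0 : 0 < weightedF a n (k + i) := hc.trans_le hw
  have h1 := mul_decayRate_le_totalRate hD0 k hi
  have h2 : 0 ≤ ((k + i : ℕ) : ℝ) * decayRate D (k + i) :=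
    mul_nonneg (Nat.cast_nonneg _) (decayRate_nonneg hD0 _)
  have h3 := h2.trans h1
  gcongr

theorem Balanced.choose_two_sq_div_le {D : ℝ} {m : ℕ} (h : Balanced D n m) (hD : 1 ≤ D)
    (hm : 1 ≤ m) (hn : 2 ≤ n) : (m.choose 2 : ℝ) ^ 2 / n.choose 2 ≤ decayRate D m := by
  have e : ∀ l : ℕ, 1 ≤ l → (2 : ℝ) * l.choose 2 = l * (l - 1) := fun l hl => by
    have := two_mul_choose_two l
    rw [← Nat.cast_pred hl]
    exact_mod_cast this
  have hm' : (1 : ℝ) ≤ m := by exact_mod_cast hm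
  have hn' : (2 : ℝ) ≤ n := by exact_mod_cast hn
  have h1 := e m hm
  have h2 := e n (by omega)
  have h3 : (0 : ℝ) < n.choose 2 := by exact_mod_cast Nat.choose_pos hn
  have h4 : (m.choose 2 : ℝ) ≤ m ^ 2 / 2 := by nlinarith
  have h5 : (n : ℝ) ^ 2 / 4 ≤ n.choose 2 := by nlinarith
  have h6 := h.pow_four_le hD hm
  have h7 := decayRate_nonneg (D := D) (by linarith) m
  rw [div_le_iff₀ h3]
  calc (m.choose 2 : ℝ) ^ 2 ≤ ((m : ℝ) ^ 2 / 2) ^ 2 := by gcongr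
    _ = (m : ℝ) ^ 4 / 4 := by ring
    _ ≤ decayRate D m * n ^ 2 / 4 := by gcongr
    _ = decayRate D m * (n ^ 2 / 4) := by ring
    _ ≤ _ := by gcongr

theorem poissonError_nonneg (n k m : ℕ) : 0 ≤ poissonError n k m := by
  have hw1 := weightedF_nonneg zero_le_one n k
  have hw2 := weightedF_nonneg zero_le_two n m
  have hq1 := overlapSum_nonneg zero_le_one n k
  have hq2 := overlapSum_nonneg zero_le_two n m
  unfold poissonError
  positivity

theorem poissonError_le {c C D : ℝ} {k : ℕ} (hc : 0 < c) (hD : 1 ≤ D) (hk : 1 ≤ k)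
    (hkn : k + 3 ≤ n) (hbal : ∀ i < 4, Balanced D n (k + i)) (hr : totalRate D k ≤ 1)
    (h1 : c ≤ weightedF 1 n (k + 1)) (h1' : weightedF 1 n (k + 1) ≤ C)
    (h2 : c ≤ weightedF 2 n (k + 3)) (h2' : weightedF 2 n (k + 3) ≤ C) :
    poissonError n (k + 1) (k + 3) ≤ (8 * (1 + 1 / c) + 4) * C ^ 2 * totalRate D k := by
  have q1 := (hbal 1 (by omega)).overlapSum_le_totalRate (by omega) le_rfl one_le_two hD hk
    (by omega) hr hc h1
  have q2 := (hbal 3 (by omega)).overlapSum_le_totalRate (by omega) one_le_two le_rfl hD hk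
    hkn hr hc h2
  have q3 := ((hbal 3 (by omega)).choose_two_sq_div_le hD (by omega) (by omega)).trans
    (decayRate_le_totalRate (by linarith) hk (by omega))
  have n1 := overlapSum_nonneg zero_le_one n (k + 1)
  have n2 := overlapSum_nonneg zero_le_two n (k + 3)
  have w1 := hc.trans_le h1
  have w2 := hc.trans_le h2
  have hC := w1.trans_le h1'
  have hr0 : 0 ≤ totalRate D k := le_trans (by positivity) q3
  calc poissonError n (k + 1) (k + 3) ≤ 2 * C ^ 2 * (totalRate D k * (1 + 1 / c)) +
        (4 * C * C + 2 * C ^ 2) * (totalRate D k * (1 + 1 / c)) +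
        totalRate D k * (C + C) ^ 2 := by
        unfold poissonError
        gcongr
    _ = _ := by ring

theorem deviationBound_le {c C D : ℝ} {k : ℕ} (hc : 0 < c) (hD : 1 ≤ D) (hk : 1 ≤ k)
    (hkn : k + 3 ≤ n) (hbal : ∀ i < 4, Balanced D n (k + i)) (hr : totalRate D k ≤ 1)
    (h1 : c ≤ weightedF 1 n (k + 1)) (h1' : weightedF 1 n (k + 1) ≤ C)
    (h2 : c ≤ weightedF 2 n (k + 3)) (h2' : weightedF 2 n (k + 3) ≤ C) :
    deviationBound n k ≤ (4 * C + 64 / c + 64 * (1 + 2 / c)) * totalRate D k := by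
  have hD0 : 0 ≤ D := by linarith
  have r0 := decayRate_le_totalRate hD0 hk (i := 0) (by omega)
  have r1 := decayRate_le_totalRate hD0 hk (i := 1) (by omega)
  have r2 := decayRate_le_totalRate hD0 hk (i := 2) (by omega)
  have r3 := decayRate_le_totalRate hD0 hk (i := 3) (by omega)
  have hr0 := (decayRate_nonneg hD0 _).trans r0
  have w1 := hc.trans_le h1
  have w2 := hc.trans_le h2
  have hC := w1.trans_le h1'
  have s1 := weightedF_succ_le zero_le_one one_le_two hD (hbal 1 (by omega)) (by omega) (by omega)
  have s3 := weightedF_succ_le zero_le_two le_rfl hD (hbal 3 (by omega)) (by omega) (by omega)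
  have s0 := weightedF_succ_le zero_le_one one_le_two hD (hbal 0 (by omega)) (by omega) (by omega)
  have s2 := weightedF_succ_le zero_le_two le_rfl hD (hbal 2 (by omega)) (by omega) (by omega)
  have d1 := decayRate_nonneg hD0 (k + 1)
  have d3 := decayRate_nonneg hD0 (k + 3)
  have v0 := weightedF_pos one_pos (show k ≤ n by omega)
  have v2 := weightedF_pos two_pos (show k + 2 ≤ n by omega)
  have t0 : c ≤ weightedF 1 n k * (2 * totalRate D k) :=
    h1.trans (s0.trans (by rw [add_zero] at *; gcongr))
  have t2 : c ≤ weightedF 2 n (k + 2) * (2 * totalRate D k) := h2.trans (s2.trans (by gcongr))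
  have u0 : c / 2 ≤ weightedF 1 n k := by nlinarith
  have u2 : c / 2 ≤ weightedF 2 n (k + 2) := by nlinarith
  have o0 := (hbal 0 (by omega)).overlapSum_le_totalRate (c := c / 2) (by omega) le_rfl one_le_two
    hD hk (by omega) hr (by linarith) u0
  have o2 := (hbal 2 (by omega)).overlapSum_le_totalRate (c := c / 2) (by omega) one_le_two le_rfl
    hD hk (by omega) hr (by linarith) u2
  rw [add_zero] at o0
  have i0 : 16 / weightedF 1 n k ≤ 32 / c * totalRate D k := by
    rw [div_mul_eq_mul_div, div_le_div_iff₀ v0 hc]; linarith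
  have i2 : 16 / weightedF 2 n (k + 2) ≤ 32 / c * totalRate D k := by
    rw [div_mul_eq_mul_div, div_le_div_iff₀ v2 hc]; linarith
  have j1 : weightedF 1 n (k + 2) ≤ C * (2 * totalRate D k) := s1.trans (by gcongr)
  have j3 : weightedF 2 n (k + 4) ≤ C * (2 * totalRate D k) := s3.trans (by gcongr)
  have hcc : 1 / (c / 2) = 2 / c := by field_simp
  rw [hcc] at o0 o2
  calc deviationBound n k ≤ C * (2 * totalRate D k) + C * (2 * totalRate D k) +
        (32 / c * totalRate D k + 32 * (totalRate D k * (1 + 2 / c))) +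
        (32 / c * totalRate D k + 32 * (totalRate D k * (1 + 2 / c))) := by
        unfold deviationBound
        gcongr
    _ = _ := by ring

end

theorem Balanced.forall_lt_four {D : ℝ} {n k : ℕ} (h : Balanced D n (k + 1)) (hD : 0 ≤ D)
    (hk : 1 ≤ k) : ∀ i < 4, Balanced (64 * D) n (k + i) := by
  intro i hi
  interval_cases i
  · exact (h.pred hD hk).mono (by linarith)
  · exact h.mono (by linarith)
  · exact (h.succ hD (by omega)).mono (by linarith)
  · exact ((h.succ hD (by omega)).succ (by linarith) (by omega)).mono (by linarith)

theorem Balanced.sq_le {D : ℝ} {n m : ℕ} (h : Balanced D n m) (hD : 1 ≤ D) (hm : 1 ≤ m)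
    (hr : decayRate D m ≤ 1) : m ^ 2 ≤ n := by
  have h1 := h.pow_four_le hD hm
  have h2 : ((m : ℝ) ^ 2) ^ 2 ≤ (n : ℝ) ^ 2 := by
    calc ((m : ℝ) ^ 2) ^ 2 = (m : ℝ) ^ 4 := by ring
      _ ≤ decayRate D m * n ^ 2 := h1
      _ ≤ 1 * n ^ 2 := by gcongr
      _ = _ := one_mul _
  have h3 := le_of_pow_le_pow_left₀ two_ne_zero (by positivity) h2
  exact_mod_cast h3

/-- Quantitative form of the four-case description, with explicit error `totalRate D k`. -/
theorem exists_prob_bounds {c1 c2 : ℝ} (hc1 : 0 < c1) :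
    ∃ D δ A : ℝ, 0 < δ ∧ ∀ n k : ℕ, 2 ≤ k → c1 ≤ f n (k + 1) → f n (k + 1) ≤ c2 →
      totalRate D k ≤ 1 →
      1 - A * totalRate D k ≤ (erdosRenyi n (1 / 2)).real
        {ω | (alpha (graphOf n ω) = k + 1 ∧ beta (graphOf n ω) = k + 3) ∨
             (alpha (graphOf n ω) = k + 1 ∧ beta (graphOf n ω) = k + 2) ∨
             (alpha (graphOf n ω) = k ∧ beta (graphOf n ω) = k + 3) ∨
             (alpha (graphOf n ω) = k ∧ beta (graphOf n ω) = k + 2)} ∧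
      ∀ e1 e2 : ℕ, e1 ≤ 1 → e2 ≤ 1 → δ - A * totalRate D k ≤ (erdosRenyi n (1 / 2)).real
        {ω | alpha (graphOf n ω) = k + 1 - e1 ∧ beta (graphOf n ω) = k + 3 - e2} := by
  obtain ⟨D, hD, hbal⟩ := exists_balanced (c2 := c2) hc1
  set c := min c1 (c1 / (12 * D))
  set C := max c2 (2 * c2 * D)
  have hc : 0 < c := lt_min hc1 (by positivity)
  set A1 := (8 * (1 + 1 / c) + 4) * C ^ 2
  set A2 := 4 * C + 64 / c + 64 * (1 + 2 / c)
  refine ⟨64 * D, poissonGap c C ^ 2, 3 * A1 + A2, pow_pos (poissonGap_pos hc C) 2,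
    fun n k hk hl hu hr => ?_⟩
  have hD' : 1 ≤ 64 * D := by linarith
  have hb := hbal n (k + 1) (by omega) hl hu
  have hb4 := hb.forall_lt_four (by linarith) (by omega)
  have hrate := decayRate_le_totalRate (D := 64 * D) (k := k) (i := 1) (by linarith)
    (by omega) (by omega)
  have hsq := (hb4 1 (by omega)).sq_le hD' (by omega) (hrate.trans hr)
  have hkn : 2 * (k + 2) ≤ n := by nlinarith
  have hw1 : weightedF 1 n (k + 1) = f n (k + 1) := by simp [weightedF]
  have hw2 := hb.weightedF_two_bounds hD hc1.le (by omega) hkn hl hu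
  have h1 : c ≤ weightedF 1 n (k + 1) := hw1 ▸ (min_le_left _ _).trans hl
  have h1' : weightedF 1 n (k + 1) ≤ C := hw1 ▸ hu.trans (le_max_left _ _)
  have h2 : c ≤ weightedF 2 n (k + 3) := (min_le_right _ _).trans hw2.1
  have h2' : weightedF 2 n (k + 3) ≤ C := hw2.2.trans (le_max_right _ _)
  have hp := poissonError_le hc hD' (by omega) (by omega) hb4 hr h1 h1' h2 h2'
  have hd := deviationBound_le hc hD' (by omega) (by omega) hb4 hr h1 h1' h2 h2'
  have hp0 := poissonError_nonneg n (k + 1) (k + 3)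
  refine ⟨le_trans ?_ (prob_four_cases_ge (by omega)), fun e1 e2 he1 he2 =>
    le_trans ?_ (prob_case_ge hc (by omega) (by omega) h1 h1' h2 h2' he1 he2)⟩
  · linarith
  · linarith

theorem tendsto_of_f_bounds {c1 c2 : ℝ} (hc1 : 0 < c1) {s k : ℕ → ℕ} (hs : StrictMono s)
    (hf : ∀ j, c1 ≤ f (s j) (k j + 1) ∧ f (s j) (k j + 1) ≤ c2) : Tendsto k atTop atTop := by
  obtain ⟨D, hD, hbal⟩ := exists_balanced (c2 := c2) hc1
  refine tendsto_atTop.2 fun b => ?_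
  obtain ⟨N, hN⟩ := exists_nat_gt (D * (b : ℝ) ^ 2 * 2 ^ b)
  filter_upwards [eventually_ge_atTop N, eventually_ge_atTop 1] with j hj hj1
  by_contra! hkb
  have h1 := (hbal (s j) (k j + 1) (by omega) (hf j).1 (hf j).2).le_right
  have h2 : ((k j + 1 : ℕ) : ℝ) ≤ b := by exact_mod_cast hkb
  have h3 : (N : ℝ) ≤ s j := by exact_mod_cast hj.trans (hs.le_apply)
  have h4 : (1 : ℝ) ≤ s j := by exact_mod_cast hj1.trans (hs.le_apply)
  have h5 : D * ((k j + 1 : ℕ) : ℝ) ^ 2 * 2 ^ (k j + 1) ≤ D * (b : ℝ) ^ 2 * 2 ^ b := by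
    gcongr
    · norm_num
    · omega
  nlinarith

theorem prob_case_le (n k e1 e2 : ℕ) (he1 : e1 ≤ 1) :
    (erdosRenyi n (1 / 2)).real
        {ω | alpha (graphOf n ω) = k + 1 - e1 ∧ beta (graphOf n ω) = k + 3 - e2} ≤
      1 - (erdosRenyi n (1 / 2)).real
        {ω | alpha (graphOf n ω) = k + 1 - (1 - e1) ∧ beta (graphOf n ω) = k + 3 - e2} := by
  rw [← probReal_compl_eq_one_sub (MeasurableSet.of_discrete)]
  refine measureReal_mono fun ω hω hω' => ?_
  have h1 := hω.1
  have h2 := hω'.1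
  omega

/-- along a sequence with `c1 ≤ f(k₀+1) ≤ c2`, whp one of four possibilities for
`(α(G), β(G))` (shifted by one) holds, each with probability bounded away from 0 and 1. -/
theorem four_cases_at_k0_add_one
    (c1 c2 : ℝ) (hc1 : 0 < c1) (hc12 : c1 ≤ c2)
    (s : ℕ → ℕ) (hs : StrictMono s)
    (hf : ∀ j, c1 ≤ f (s j) (k0 (s j) + 1) ∧ f (s j) (k0 (s j) + 1) ≤ c2) :
    (Tendsto (fun j => erdosRenyi (s j) (1/2)
      {ω | (alpha (graphOf (s j) ω) = k0 (s j) + 1 ∧ beta (graphOf (s j) ω) = k0 (s j) + 3) ∨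
           (alpha (graphOf (s j) ω) = k0 (s j) + 1 ∧ beta (graphOf (s j) ω) = k0 (s j) + 2) ∨
           (alpha (graphOf (s j) ω) = k0 (s j) ∧ beta (graphOf (s j) ω) = k0 (s j) + 3) ∨
           (alpha (graphOf (s j) ω) = k0 (s j) ∧ beta (graphOf (s j) ω) = k0 (s j) + 2)})
      atTop (nhds 1)) ∧
    (∀ e1 e2 : ℕ, e1 ≤ 1 → e2 ≤ 1 →
      0 < Filter.liminf (fun j => erdosRenyi (s j) (1/2)
        {ω | alpha (graphOf (s j) ω) = k0 (s j) + 1 - e1 ∧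
             beta (graphOf (s j) ω) = k0 (s j) + 3 - e2}) atTop ∧
      Filter.limsup (fun j => erdosRenyi (s j) (1/2)
        {ω | alpha (graphOf (s j) ω) = k0 (s j) + 1 - e1 ∧
             beta (graphOf (s j) ω) = k0 (s j) + 3 - e2}) atTop < 1) := by
  obtain ⟨D, δ, A, hδ, hbounds⟩ := exists_prob_bounds (c2 := c2) hc1
  have hk := tendsto_of_f_bounds hc1 hs hf
  have hrate : Tendsto (fun j => totalRate D (k0 (s j))) atTop (nhds 0) :=
    (tendsto_totalRate D).comp hk
  have hev : ∀ᶠ j in atTop, 2 ≤ k0 (s j) ∧ totalRate D (k0 (s j)) ≤ 1 :=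
    (hk.eventually_ge_atTop 2).and (hrate.eventually_le_const one_pos)
  have hArate : Tendsto (fun j => A * totalRate D (k0 (s j))) atTop (nhds 0) := by
    simpa using hrate.const_mul A
  refine ⟨?_, fun e1 e2 he1 he2 => ?_⟩
  · have hlow : Tendsto (fun j => ENNReal.ofReal (1 - A * totalRate D (k0 (s j)))) atTop
        (nhds 1) := by
      simpa using ENNReal.tendsto_ofReal (hArate.const_sub 1)
    refine tendsto_of_tendsto_of_tendsto_of_le_of_le' hlow tendsto_const_nhds ?_
      (.of_forall fun _ => prob_le_one)
    filter_upwards [hev] with j hj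
    exact ENNReal.ofReal_le_of_le_toReal (hbounds _ _ hj.1 (hf j).1 (hf j).2 hj.2).1
  · have hhalf : ∀ᶠ j in atTop, ∀ e1 ≤ 1, δ / 2 ≤ (erdosRenyi (s j) (1 / 2)).real
        {ω | alpha (graphOf (s j) ω) = k0 (s j) + 1 - e1 ∧
             beta (graphOf (s j) ω) = k0 (s j) + 3 - e2} := by
      filter_upwards [hev, hArate.eventually_le_const (half_pos hδ)] with j hj hA e1 he1
      have := (hbounds _ _ hj.1 (hf j).1 (hf j).2 hj.2).2 e1 e2 he1 he2
      linarith
    constructor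
    · refine (ENNReal.ofReal_pos.2 (half_pos hδ)).trans_le
        (le_liminf_of_le (by isBoundedDefault) ?_)
      filter_upwards [hhalf] with j hj
      exact ENNReal.ofReal_le_of_le_toReal (hj e1 he1)
    · refine (limsup_le_of_le (a := ENNReal.ofReal (1 - δ / 2))
        (by isBoundedDefault) ?_).trans_lt ?_
      · filter_upwards [hhalf] with j hj
        rw [← ofReal_measureReal]
        refine ENNReal.ofReal_le_ofReal ((prob_case_le _ _ e1 e2 he1).trans ?_)
        linarith [hj (1 - e1) (by omega)]
      · rw [ENNReal.ofReal_lt_one]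
        linarith

end RandomBipartiteDecomposition
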